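/- Let X be a Peano space whose maximal cyclic subsets are compact surfaces and let C ⊂ X be an admissible subcontinuum. Then C is a 1-cactoid, i.e. C is a Peano space all of whose maximal cyclic subsets are homeomorphic to the 1-sphere. -/

import Mathlib

open Filter Topology Metric Set GromovHausdorff
open scoped ENNReal unitInterval

noncomputable section

/-! ## Model spaces -/

/-- The closed upper half plane in `ℝ × ℝ` (used for topological charts). -/
def HalfPlane : Set (ℝ × ℝ) := {p | 0 ≤ p.2}

/-- The closed upper half plane in the Euclidean plane (used for metric charts). -/
def EHalfPlane : Set (EuclideanSpace ℝ (Fin 2)) := {p | 0 ≤ p 1}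

/-- The unit circle (the 1-sphere). -/
def Circle1 : Set (EuclideanSpace ℝ (Fin 2)) := Metric.sphere 0 1

/-- The 2-sphere. -/
def Sphere2 : Set (EuclideanSpace ℝ (Fin 3)) := Metric.sphere 0 1

/-- The closed 2-disc. -/
def Disc2 : Set (EuclideanSpace ℝ (Fin 2)) := Metric.closedBall 0 1

/-- The relation on the unit square generating the Möbius identification
`(0, y) ∼ (1, 1 - y)`. -/
def mobiusRel (p q : I × I) : Prop :=
  ((p.1 : ℝ) = 0 ∧ (q.1 : ℝ) = 1 ∧ (p.2 : ℝ) = 1 - (q.2 : ℝ)) ∨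
  ((p.1 : ℝ) = 1 ∧ (q.1 : ℝ) = 0 ∧ (p.2 : ℝ) = 1 - (q.2 : ℝ))

/-- The Möbius band, as a quotient of the unit square. -/
def MobiusBand : Type := Quot mobiusRel

instance : TopologicalSpace MobiusBand :=
  inferInstanceAs (TopologicalSpace (Quot mobiusRel))

/-! ## Surfaces -/

/-- A topological 2-manifold with (possibly empty) boundary: every point has an open
neighborhood homeomorphic to an open subset of the closed half plane. -/
def IsSurface (X : Type*) [TopologicalSpace X] : Prop :=
  ∀ x : X, ∃ (U : Set X) (V : Set HalfPlane),
    IsOpen U ∧ x ∈ U ∧ IsOpen V ∧ Nonempty (↥U ≃ₜ ↥V)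

/-- A compact surface: a compact connected (Hausdorff) topological 2-manifold with
possibly empty boundary. -/
def IsCompactSurface (X : Type*) [TopologicalSpace X] : Prop :=
  CompactSpace X ∧ ConnectedSpace X ∧ T2Space X ∧ IsSurface X

/-- The (manifold) boundary of a surface: the set of points having no open neighborhood
homeomorphic to an open subset of the plane. -/
def surfaceBoundary (X : Type*) [TopologicalSpace X] : Set X :=
  {x | ¬ ∃ (U : Set X) (V : Set (ℝ × ℝ)), IsOpen U ∧ x ∈ U ∧ IsOpen V ∧ Nonempty (↥U ≃ₜ ↥V)}

/-- The set of boundary components of a surface, i.e. the connected components of the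
boundary. -/
def surfaceBoundaryComponents (X : Type*) [TopologicalSpace X] : Set (Set X) :=
  {b | ∃ x ∈ surfaceBoundary X, b = connectedComponentIn (surfaceBoundary X) x}

/-- A surface is orientable iff it contains no subset homeomorphic to the Möbius band. -/
def SurfOrientable (X : Type*) [TopologicalSpace X] : Prop :=
  ¬ ∃ A : Set X, Nonempty (↥A ≃ₜ MobiusBand)

/-- The free rank of the first homology (the abelianized fundamental group). -/
noncomputable def h1Rank (X : Type*) [TopologicalSpace X] : ℕ :=
  ⨆ x : X, (Module.rank ℤ (Additive (Abelianization (FundamentalGroup X x)))).toNat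

open Classical in
/-- The connectivity number of a compact surface `S`, i.e. `2 - χ(S)`.  By the
classification of compact surfaces this equals the free rank of the first homology,
plus one unless the surface is closed and orientable. -/
noncomputable def connNum (X : Type*) [TopologicalSpace X] : ℕ :=
  h1Rank X + (if surfaceBoundary X = ∅ ∧ SurfOrientable X then 0 else 1)

/-- The reduced connectivity number: the connectivity number minus the number of
boundary components. -/
noncomputable def redConnNum (X : Type*) [TopologicalSpace X] : ℤ :=
  (connNum X : ℤ) - ((surfaceBoundaryComponents X).ncard : ℤ)

/-! ## Length and geodesic spaces -/

/-- The length of a path, as the total variation of the parametrization. -/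
noncomputable def pathLength {X : Type*} [MetricSpace X] {x y : X} (γ : Path x y) : ℝ≥0∞ :=
  eVariationOn (fun t => γ t) Set.univ

/-- A metric space is a length space if the distance between any two points is the
infimum of the lengths of paths joining them. -/
def IsLengthSpace (X : Type*) [MetricSpace X] : Prop :=
  ∀ x y : X, edist x y = ⨅ γ : Path x y, pathLength γ

/-- A metric space is geodesic if any two points are joined by a path whose length
realizes the distance. -/
def IsGeodesicSpace (X : Type*) [MetricSpace X] : Prop :=
  ∀ x y : X, ∃ γ : Path x y, pathLength γ = edist x y

/-! ## Peano spaces, Jordan curves and cyclic elements -/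

/-- A Peano space: a compact connected locally connected metric space. -/
def IsPeano (X : Type*) [MetricSpace X] : Prop :=
  CompactSpace X ∧ ConnectedSpace X ∧ LocallyConnectedSpace X

/-- A Jordan curve: a subset homeomorphic to the 1-sphere. -/
def IsJordanCurve {X : Type*} [TopologicalSpace X] (J : Set X) : Prop :=
  Nonempty (↥J ≃ₜ ↥Circle1)

/-- A set is cyclicly connected if every pair of distinct points of it lies on a common
Jordan curve contained in it. -/
def CycliclyConnected {X : Type*} [TopologicalSpace X] (A : Set X) : Prop :=
  ∀ x ∈ A, ∀ y ∈ A, x ≠ y → ∃ J : Set X, J ⊆ A ∧ IsJordanCurve J ∧ x ∈ J ∧ y ∈ J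

/-- A maximal cyclic subset: a nondegenerate cyclicly connected subset which is not a
proper subset of any cyclicly connected subset. -/
def IsMaximalCyclic {X : Type*} [TopologicalSpace X] (A : Set X) : Prop :=
  A.Nontrivial ∧ CycliclyConnected A ∧ ∀ B : Set X, CycliclyConnected B → A ⊆ B → A = B

/-- A subcontinuum: a compact connected (hence nonempty) subset. -/
def IsSubcontinuum {X : Type*} [TopologicalSpace X] (C : Set X) : Prop :=
  IsCompact C ∧ IsConnected C

/-- `b` is a boundary component of the subset `T` (viewed as a subspace). -/
def IsBoundaryComponentOf {X : Type*} [TopologicalSpace X] (T b : Set X) : Prop :=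
  ∃ b' ∈ surfaceBoundaryComponents ↥T, b = Subtype.val '' b'

/-- An admissible subcontinuum: it meets every maximal cyclic subset `T` in at most a
point or in a boundary component of `T`. -/
def IsAdmissible {X : Type*} [TopologicalSpace X] (C : Set X) : Prop :=
  IsSubcontinuum C ∧
    ∀ T : Set X, IsMaximalCyclic T →
      ((T ∩ C).Subsingleton ∨ IsBoundaryComponentOf T (T ∩ C))

/-- A 1-cactoid: a Peano space all of whose maximal cyclic subsets are homeomorphic to
the 1-sphere. -/
def IsOneCactoid (X : Type*) [MetricSpace X] : Prop :=
  IsPeano X ∧ ∀ T : Set X, IsMaximalCyclic T → Nonempty (↥T ≃ₜ ↥Circle1)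

/-- A subset homeomorphic to the 2-sphere or the closed 2-disc. -/
def SphereOrDisc {X : Type*} [TopologicalSpace X] (T : Set X) : Prop :=
  Nonempty (↥T ≃ₜ ↥Sphere2) ∨ Nonempty (↥T ≃ₜ ↥Disc2)

/-! ## Generalized cactoids -/

/-- A generalized cactoid. -/
def IsGeneralizedCactoid (X : Type*) [MetricSpace X] : Prop :=
  IsPeano X ∧ (∀ T : Set X, IsMaximalCyclic T → IsCompactSurface ↥T) ∧
  {T : Set X | IsMaximalCyclic T ∧ ¬ SphereOrDisc T}.Finite ∧
  ∃ (n : ℕ) (C : Fin n → Set X),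
    (∀ i, IsAdmissible (C i)) ∧ (Pairwise fun i j => Disjoint (C i) (C j)) ∧
    ∀ T b : Set X, IsMaximalCyclic T → IsBoundaryComponentOf T b → b ⊆ ⋃ i, C i

/-- A pre-boundary consisting of `n` disjoint admissible subcontinua, each containing a
boundary component of some maximal cyclic subset, which together cover all boundary
components of all maximal cyclic subsets. -/
def IsPreBoundaryOfSize {X : Type*} [TopologicalSpace X] (n : ℕ) (P : Set X) : Prop :=
  ∃ C : Fin n → Set X,
    (∀ i, IsAdmissible (C i)) ∧ (Pairwise fun i j => Disjoint (C i) (C j)) ∧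
    (∀ i, ∃ T b : Set X, IsMaximalCyclic T ∧ IsBoundaryComponentOf T b ∧ b ⊆ C i) ∧
    (∀ T b : Set X, IsMaximalCyclic T → IsBoundaryComponentOf T b → b ⊆ ⋃ i, C i) ∧
    P = ⋃ i, C i

def IsPreBoundary {X : Type*} [TopologicalSpace X] (P : Set X) : Prop :=
  ∃ n, IsPreBoundaryOfSize n P

/-- A minimal pre-boundary: one with the minimal possible number of pieces. -/
def IsMinimalPreBoundary {X : Type*} [TopologicalSpace X] (P : Set X) : Prop :=
  ∃ n, IsPreBoundaryOfSize n P ∧ ∀ (m : ℕ) (Q : Set X), IsPreBoundaryOfSize m Q → n ≤ m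

/-- The boundary of a generalized cactoid: the union of all minimal pre-boundaries. -/
def cactoidBoundary (X : Type*) [TopologicalSpace X] : Set X :=
  ⋃₀ {P : Set X | IsMinimalPreBoundary P}

/-- The boundary components of a generalized cactoid: the connected components of its
boundary. -/
def cactoidBoundaryComponents (X : Type*) [TopologicalSpace X] : Set (Set X) :=
  {b | ∃ x ∈ cactoidBoundary X, b = connectedComponentIn (cactoidBoundary X) x}

/-- The connectivity number of a generalized cactoid: the sum of the reduced
connectivity numbers of its maximal cyclic subsets plus the number of its boundary
components. -/
noncomputable def cactoidConnNum (X : Type*) [TopologicalSpace X] : ℤ :=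
  (∑ᶠ T ∈ {T : Set X | IsMaximalCyclic T}, redConnNum ↥T) +
    ((cactoidBoundaryComponents X).ncard : ℤ)

/-! ## Bundled spaces -/

structure BundledMet where
  carrier : Type
  [str : MetricSpace carrier]

attribute [instance] BundledMet.str

structure BundledTop where
  carrier : Type
  [str : TopologicalSpace carrier]

attribute [instance] BundledTop.str

/-! ## Metric two-point identifications -/

/-- `p : A → B` is (the projection of) a metric 2-point identification: it glues exactly
two distinct points `x₁, x₂` of `A` and carries the corresponding quotient metric. -/
def IsTwoPointIdentification {A B : Type*} [MetricSpace A] [MetricSpace B] (p : A → B) : Prop :=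
  Function.Surjective p ∧ ∃ x₁ x₂ : A, x₁ ≠ x₂ ∧
    (∀ a b : A, p a = p b ↔ (a = b ∨ (a = x₁ ∧ b = x₂) ∨ (a = x₂ ∧ b = x₁))) ∧
    ∀ a b : A, dist (p a) (p b) =
      min (dist a b) (min (dist a x₁ + dist x₂ b) (dist a x₂ + dist x₁ b))

/-- `Y` is obtained from `X` by a successive application of `k` metric 2-point
identifications, exactly `k₀` of which are boundary identifications with respect to the
subset `B ⊆ X`. -/
def ObtainedByIdentifications (X : Type) [MetricSpace X] (B : Set X) (k k0 : ℕ)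
    (Y : Type) [MetricSpace Y] : Prop :=
  ∃ (Z : ℕ → BundledMet) (p : ∀ i : ℕ, (Z i).carrier → (Z (i + 1)).carrier)
    (e : X ≃ᵢ (Z 0).carrier) (f : (Z k).carrier ≃ᵢ Y) (q : ∀ i : ℕ, X → (Z i).carrier),
    (∀ i, i < k → IsTwoPointIdentification (p i)) ∧
    (∀ x, q 0 x = e x) ∧ (∀ i x, q (i + 1) x = p i (q i x)) ∧
    {i : ℕ | i < k ∧ ∃ a b : (Z i).carrier,
        a ∈ q i '' B ∧ b ∈ q i '' B ∧ a ≠ b ∧ p i a = p i b}.ncard = k0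

/-! ## Gromov–Hausdorff sequences of surfaces -/

/-- A sequence of (isometry classes of) compact length surfaces with connectivity
number `c`. -/
def IsSurfaceGHSeq (c : ℕ) (K : ℕ → GHSpace) : Prop :=
  ∀ n, IsCompactSurface (K n).Rep ∧ IsLengthSpace (K n).Rep ∧ connNum (K n).Rep = c

/-- The structural description of the limit spaces in the Main Theorem: `X` is obtained
from a geodesic generalized cactoid `Y` by `k` successive metric 2-point
identifications, `k₀` of them boundary identifications, where the connectivity number
of `Y` is at most `c + k₀ - 2k`. -/
def MainThmRHS (c : ℕ) (X : Type) [MetricSpace X] : Prop :=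
  ∃ (k k0 : ℕ) (Y : BundledMet),
    IsGeneralizedCactoid Y.carrier ∧ IsGeodesicSpace Y.carrier ∧
    ObtainedByIdentifications Y.carrier (cactoidBoundary Y.carrier) k k0 X ∧
    cactoidConnNum Y.carrier ≤ (c : ℤ) + (k0 : ℤ) - 2 * (k : ℤ)

/-! ## Covering dimension -/

/-- `X` has covering dimension at most `n`: every open cover admits an open refinement
of order at most `n + 1`. -/
def CoveringDimLE (X : Type*) [TopologicalSpace X] (n : ℕ) : Prop :=
  ∀ U : Set (Set X), (∀ u ∈ U, IsOpen u) → ⋃₀ U = Set.univ →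
    ∃ V : Set (Set X), (∀ v ∈ V, IsOpen v) ∧ ⋃₀ V = Set.univ ∧
      (∀ v ∈ V, ∃ u ∈ U, v ⊆ u) ∧
      ∀ x : X, {v | v ∈ V ∧ x ∈ v}.encard ≤ (n : ℕ∞) + 1

/-! ## Curves in surfaces -/

/-- A continuous map from the circle is nullhomotopic if it is homotopic to a constant. -/
def IsNullhomotopic {X : Type*} [TopologicalSpace X] (f : C(↥Circle1, X)) : Prop :=
  ∃ y : X, f.Homotopic (ContinuousMap.const _ y)

/-- A contractible Jordan curve. -/
def IsContractibleJordanCurve {X : Type*} [TopologicalSpace X] (J : Set X) : Prop :=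
  IsJordanCurve J ∧
    ∀ f : C(↥Circle1, X), Function.Injective f → Set.range f = J → IsNullhomotopic f

/-- A non-contractible Jordan curve. -/
def IsNonContractibleJordanCurve {X : Type*} [TopologicalSpace X] (J : Set X) : Prop :=
  IsJordanCurve J ∧
    ∀ f : C(↥Circle1, X), Function.Injective f → Set.range f = J → ¬ IsNullhomotopic f

/-- A simple arc in a surface: an injective path whose endpoints lie on the boundary and
whose interior does not. -/
def IsSimpleArc {X : Type*} [TopologicalSpace X] (γ : C(I, X)) : Prop :=
  Function.Injective γ ∧ γ 0 ∈ surfaceBoundary X ∧ γ 1 ∈ surfaceBoundary X ∧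
    ∀ t : I, t ≠ 0 → t ≠ 1 → γ t ∉ surfaceBoundary X

/-- A subset separates the space if its complement is disconnected. -/
def SeparatesSpace {X : Type*} [TopologicalSpace X] (A : Set X) : Prop :=
  ¬ IsPreconnected Aᶜ

/-- The arc `γ` forms a contractible Jordan curve together with a subarc of some
boundary component. -/
def FormsContractibleJordanWithBoundary {X : Type*} [TopologicalSpace X]
    (γ : C(I, X)) : Prop :=
  ∃ β : C(I, X), Function.Injective β ∧ Set.range β ⊆ surfaceBoundary X ∧
    β 0 = γ 0 ∧ β 1 = γ 1 ∧ IsContractibleJordanCurve (Set.range γ ∪ Set.range β)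

/-- `z` separates `x` and `y` inside the subset `A`: both lie in `A \ {z}` and no
connected subset of `A \ {z}` contains both. -/
def SeparatesIn {X : Type*} [TopologicalSpace X] (A : Set X) (z x y : X) : Prop :=
  x ∈ A \ {z} ∧ y ∈ A \ {z} ∧
    ∀ C : Set X, C ⊆ A \ {z} → IsPreconnected C → ¬ (x ∈ C ∧ y ∈ C)

/-! ## Metric doubles -/

/-- `D` together with the two canonical maps `ip, im : X → D` is the metric double of
`X` along the subset `B`. -/
structure IsMetricDouble (X : Type*) [MetricSpace X] (B : Set X) (D : Type*)
    [MetricSpace D] (ip im : X → D) : Prop where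
  isom_p : Isometry ip
  isom_m : Isometry im
  surj : Set.range ip ∪ Set.range im = Set.univ
  agree : ∀ z ∈ B, ip z = im z
  dist_mix : ∀ a b : X, dist (ip a) (im b) = ⨅ z : ↥B, (dist a (z : X) + dist (z : X) b)

/-- Regularity of a sequence of doubles: there is no sequence of non-contractible
Jordan curves in the doubles with vanishing diameters. -/
def RegularDoubleSeq (D : ℕ → Type) [∀ n, MetricSpace (D n)] : Prop :=
  ∀ J : ∀ n, Set (D n), (∀ n, IsNonContractibleJordanCurve (J n)) →
    0 < ⨅ n, Metric.diam (J n)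

/-- The copy `A^+` (or `A^-`) in the double limit corresponding to a subset `A` of the
limit `X`, via the isometric identification `j` of `X` with `X^+` (resp. `X^-`). -/
def plusCopy {Z D : Type*} {X : Set Z} {Xp : Set D} (j : ↥X → ↥Xp) (A : Set Z) :
    Set D :=
  (fun x => ((j x : ↥Xp) : D)) '' {x : ↥X | (x : Z) ∈ A}

/-! ## Riemannian and polyhedral surfaces -/

/-- The Riemannian length integrand `√(g_{γ(t)}(γ'(t), γ'(t)))`. -/
noncomputable def riemLengthIntegrand (g : (ℝ × ℝ) → (ℝ × ℝ) → (ℝ × ℝ) → ℝ)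
    (γ : ℝ → ℝ × ℝ) (t : ℝ) : ℝ :=
  Real.sqrt (g (γ t) (deriv γ t) (deriv γ t))

/-- A compact connected smooth Riemannian 2-manifold, as a metric space: a compact
length surface such that around every point there is a chart in which the length of
every C¹ curve is computed by a smooth positive definite symmetric bilinear metric. -/
def IsSmoothRiemannianSurface (X : Type*) [MetricSpace X] : Prop :=
  IsCompactSurface X ∧ IsLengthSpace X ∧
  ∀ x : X, ∃ (U : Set X) (V : Set (ℝ × ℝ)) (φ : X → ℝ × ℝ) (ψ : ℝ × ℝ → X)
      (g : (ℝ × ℝ) → (ℝ × ℝ) → (ℝ × ℝ) → ℝ),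
    IsOpen U ∧ x ∈ U ∧ (∃ V' : Set (ℝ × ℝ), IsOpen V' ∧ V = V' ∩ HalfPlane) ∧
    ContinuousOn φ U ∧ φ '' U = V ∧ ContinuousOn ψ V ∧
    (∀ y ∈ U, ψ (φ y) = y) ∧ (∀ v ∈ V, φ (ψ v) = v) ∧
    (∀ m : ℕ, ContDiffOn ℝ m
      (fun pq : (ℝ × ℝ) × (ℝ × ℝ) × (ℝ × ℝ) => g pq.1 pq.2.1 pq.2.2)
      (V ×ˢ ((Set.univ : Set (ℝ × ℝ)) ×ˢ (Set.univ : Set (ℝ × ℝ))))) ∧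
    (∀ p u v, g p u v = g p v u) ∧
    (∀ p (a : ℝ) u u' v, g p (a • u + u') v = a * g p u v + g p u' v) ∧
    (∀ p ∈ V, ∀ u : ℝ × ℝ, u ≠ 0 → 0 < g p u u) ∧
    ∀ (cur : ℝ → X) (a b : ℝ), a ≤ b → Set.MapsTo cur (Set.Icc a b) U →
      ContDiffOn ℝ 1 (φ ∘ cur) (Set.Icc a b) →
      eVariationOn cur (Set.Icc a b) =
        ENNReal.ofReal (∫ t in a..b, riemLengthIntegrand g (φ ∘ cur) t)

/-- A polyhedral surface: a compact length surface which is flat (locally isometric to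
a subset of the Euclidean half plane) away from finitely many singular points. -/
def IsPolyhedralSurface (X : Type*) [MetricSpace X] : Prop :=
  IsCompactSurface X ∧ IsLengthSpace X ∧
  ∃ F : Set X, F.Finite ∧ ∀ x : X, x ∉ F →
    ∃ (U : Set X) (W : Set (EuclideanSpace ℝ (Fin 2))),
      IsOpen U ∧ x ∈ U ∧ W ⊆ EHalfPlane ∧ Nonempty (↥U ≃ᵢ ↥W)

end

/-! ## Paths in compact locally connected metric spaces -/

/-- Two points are linked at scale `ε` if they lie in a common connected set whose points are
pairwise at distance at most `ε`. -/
def Linked {X : Type*} [MetricSpace X] (ε : ℝ) (x y : X) : Prop :=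
  ∃ S : Set X, IsPreconnected S ∧ x ∈ S ∧ y ∈ S ∧ ∀ a ∈ S, ∀ b ∈ S, dist a b ≤ ε

theorem exists_connected_open_small {X : Type*} [MetricSpace X] [LocallyConnectedSpace X]
    (x : X) {ε : ℝ} (hε : 0 < ε) :
    ∃ V : Set X, IsOpen V ∧ IsPreconnected V ∧ x ∈ V ∧ V ⊆ ball x ε ∧
      ∀ a ∈ V, ∀ b ∈ V, dist a b ≤ ε := by
  have hx : x ∈ ball x (ε / 2) := mem_ball_self (half_pos hε)
  refine ⟨connectedComponentIn (ball x (ε / 2)) x, isOpen_ball.connectedComponentIn,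
    isPreconnected_connectedComponentIn, mem_connectedComponentIn hx,
    (connectedComponentIn_subset _ _).trans (ball_subset_ball (by linarith)), ?_⟩
  intro a ha b hb
  have h1 := connectedComponentIn_subset _ _ ha
  have h2 := connectedComponentIn_subset _ _ hb
  rw [mem_ball] at h1 h2
  have := dist_triangle_right a b x
  linarith

theorem exists_uniform_chain {X : Type*} [MetricSpace X] [CompactSpace X]
    [LocallyConnectedSpace X] {η : ℝ} (hη : 0 < η) :
    ∃ N : ℕ, 0 < N ∧ ∀ (S : Set X), IsPreconnected S → ∀ x ∈ S, ∀ y ∈ S,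
      ∃ p : ℕ → X, p 0 = x ∧ p N = y ∧ (∀ i, Linked η (p i) (p (i + 1))) ∧
        ∀ i, ∃ s ∈ S, dist (p i) s ≤ η := by
  classical
  choose V hVo hVc hVx _ hVd using
    fun z : X => exists_connected_open_small z hη
  obtain ⟨t, ht⟩ := isCompact_univ.elim_finite_subcover V hVo
    (fun z _ => mem_iUnion.2 ⟨z, hVx z⟩)
  refine ⟨Fintype.card t + 1, Nat.succ_pos _, ?_⟩
  intro S hS x hx y hy
  have cov : ∀ z : X, ∃ i : t, z ∈ V i := by
    intro z
    obtain ⟨i, hi, hz⟩ := mem_iUnion₂.1 (ht (mem_univ z))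
    exact ⟨⟨i, hi⟩, hz⟩
  let G : SimpleGraph t :=
    { Adj := fun i j => i ≠ j ∧ (V i ∩ V j).Nonempty ∧ (V i ∩ S).Nonempty ∧ (V j ∩ S).Nonempty
      symm := ⟨fun i j ⟨h1, h2, h3, h4⟩ => ⟨h1.symm, by rwa [inter_comm], h4, h3⟩⟩
      loopless := ⟨fun i h => h.1 rfl⟩ }
  obtain ⟨i0, hi0⟩ := cov x
  obtain ⟨j0, hj0⟩ := cov y
  have hreach : G.Reachable i0 j0 := by
    by_contra hn
    let A : Set X := ⋃ i ∈ {i : t | G.Reachable i0 i}, V i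
    let B : Set X := ⋃ i ∈ {i : t | ¬ G.Reachable i0 i}, V i
    have hA : IsOpen A := isOpen_biUnion fun i _ => hVo i
    have hB : IsOpen B := isOpen_biUnion fun i _ => hVo i
    have hAB : S ⊆ A ∪ B := by
      intro z _
      obtain ⟨i, hi⟩ := cov z
      by_cases h : G.Reachable i0 i
      · exact Or.inl (mem_biUnion (show i ∈ {i : t | G.Reachable i0 i} from h) hi)
      · exact Or.inr (mem_biUnion (show i ∈ {i : t | ¬ G.Reachable i0 i} from h) hi)
    obtain ⟨z, hzS, hzA, hzB⟩ := hS A B hA hB hAB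
      ⟨x, hx, mem_biUnion (show i0 ∈ {i : t | G.Reachable i0 i} from .refl _) hi0⟩
      ⟨y, hy, mem_biUnion (show j0 ∈ {i : t | ¬ G.Reachable i0 i} from hn) hj0⟩
    obtain ⟨i, hi, hzi⟩ := mem_iUnion₂.1 hzA
    obtain ⟨j, hj, hzj⟩ := mem_iUnion₂.1 hzB
    have hij : i ≠ j := fun h => hj (h ▸ hi)
    have hadj : G.Adj i j := ⟨hij, ⟨z, hzi, hzj⟩, ⟨z, hzi, hzS⟩, ⟨z, hzj, hzS⟩⟩
    exact hj (SimpleGraph.Reachable.trans hi hadj.reachable)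
  obtain ⟨w⟩ := hreach
  let w' : G.Walk i0 j0 := w.toPath
  have hlen : w'.length < Fintype.card t := w.toPath.2.length_lt
  let v : ℕ → t := fun k => w'.getVert k
  have hv0 : v 0 = i0 := w'.getVert_zero
  have hvL : ∀ k, w'.length ≤ k → v k = j0 := fun k hk => w'.getVert_of_length_le hk
  have hstep : ∀ k, v k = v (k + 1) ∨ G.Adj (v k) (v (k + 1)) := by
    intro k
    by_cases hk : k < w'.length
    · exact Or.inr (w'.adj_getVert_succ hk)
    · left; rw [hvL k (by omega), hvL (k + 1) (by omega)]
  have hmeet : ∀ k, (V (v k) ∩ S).Nonempty := by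
    intro k
    induction k with
    | zero => rw [hv0]; exact ⟨x, hi0, hx⟩
    | succ k ih =>
      rcases hstep k with h | h
      · rwa [← h]
      · exact h.2.2.2
  have hVV : ∀ k, (V (v k) ∩ V (v (k + 1))).Nonempty := by
    intro k
    rcases hstep k with h | h
    · rw [← h, inter_self]; exact ⟨_, hVx _⟩
    · exact h.2.1
  choose c hc using hVV
  let N := Fintype.card t + 1
  let p : ℕ → X := fun k => if N ≤ k then y else match k with
    | 0 => x
    | k + 1 => c k
  have hp1 : ∀ k, p k ∈ V (v k) := by
    intro k
    by_cases hk : N ≤ k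
    · simp only [p, hk, if_true]
      rw [hvL k (by omega)]; exact hj0
    · cases k with
      | zero => simp only [p, hk, if_false, hv0]; exact hi0
      | succ k => simp only [p, hk, if_false]; exact (hc k).2
  have hp2 : ∀ k, p (k + 1) ∈ V (v k) := by
    intro k
    by_cases hk : N ≤ k + 1
    · simp only [p, hk, if_true]
      rw [hvL k (by omega)]; exact hj0
    · simp only [p, hk, if_false]; exact (hc k).1
  refine ⟨p, ?_, ?_, ?_, ?_⟩
  · simp [p, N]
  · simp [p, N]
  · exact fun i => ⟨V (v i), hVc _, hp1 i, hp2 i, hVd _⟩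
  · intro i
    obtain ⟨s, hs, hsS⟩ := hmeet i
    exact ⟨s, hsS, hVd _ _ (hp1 i) _ hs⟩

/-- Points linked at scale `ε` are joined by a path of size comparable to `ε`. -/
theorem Linked.exists_path {X : Type*} [MetricSpace X] [CompactSpace X]
    [LocallyConnectedSpace X] {ε : ℝ} (hε : 0 < ε) {x y : X} (hxy : Linked ε x y) :
    ∃ γ : Path x y, ∀ t, dist (γ t) x ≤ 5 * ε := by
  classical
  let e : ℕ → ℝ := fun k => ε * (1 / 2) ^ k
  have he : ∀ k, 0 < e k := fun k => by positivity
  have heS : ∀ k, e (k + 1) = e k / 2 := fun k => by simp only [e, pow_succ]; ring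
  choose N hN0 hN using fun k => exists_uniform_chain (X := X) (he (k + 1))
  have hN' : ∀ k (a b : X), ∃ p : ℕ → X, Linked (e k) a b →
      p 0 = a ∧ p (N k) = b ∧ (∀ i, Linked (e (k + 1)) (p i) (p (i + 1))) ∧
        ∀ i, dist (p i) a ≤ 2 * e k := by
    intro k a b
    by_cases h : Linked (e k) a b
    · obtain ⟨S, hS, ha, hb, hd⟩ := h
      obtain ⟨p, h0, h1, h2, h3⟩ := hN k S hS a ha b hb
      refine ⟨p, fun _ => ⟨h0, h1, h2, fun i => ?_⟩⟩
      obtain ⟨s, hs, hds⟩ := h3 i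
      have := hd s hs a ha
      have := dist_triangle (p i) s a
      have := heS k
      have := he k
      linarith
    · exact ⟨fun _ => a, fun h' => absurd h' h⟩
  choose R hR using hN'
  let F : ℕ → ℕ → X := fun k => Nat.rec (fun j => if j = 0 then x else y)
    (fun k f j => R k (f (j / N k)) (f (j / N k + 1)) (j % N k)) k
  have hF0 : ∀ j, F 0 j = if j = 0 then x else y := fun j => rfl
  have hFS : ∀ k j, F (k + 1) j = R k (F k (j / N k)) (F k (j / N k + 1)) (j % N k) :=
    fun k j => rfl
  have hlink : ∀ k j, Linked (e k) (F k j) (F k (j + 1)) := by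
    intro k
    induction k with
    | zero =>
      intro j
      have hs : e 0 = ε := by simp [e]
      rw [hs]
      cases j with
      | zero => simpa [hF0] using hxy
      | succ j =>
        simp only [hF0]
        exact ⟨{y}, isPreconnected_singleton, by simp, by simp, by simp [hε.le]⟩
    | succ k ih =>
      intro j
      obtain ⟨r0, r1, r2, -⟩ := hR k _ _ (ih (j / N k))
      obtain ⟨s0, -, -, -⟩ := hR k _ _ (ih (j / N k + 1))
      have hlt := Nat.mod_lt j (hN0 k)
      have hdm := Nat.div_add_mod j (N k)
      rw [hFS, hFS]
      by_cases hj : j % N k + 1 < N k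
      · have h1 : (j + 1) / N k = j / N k := by
          rw [Nat.div_eq_iff (hN0 k)]
          have := Nat.mul_comm (N k) (j / N k)
          omega
        have h2 : (j + 1) % N k = j % N k + 1 := by
          have := Nat.div_add_mod (j + 1) (N k)
          rw [h1] at this
          omega
        rw [h1, h2]
        exact r2 _
      · have hj' : j % N k + 1 = N k := by omega
        have hj1 : j + 1 = N k * (j / N k + 1) := by rw [mul_add]; omega
        have h1 : (j + 1) / N k = j / N k + 1 := by
          rw [hj1]; exact Nat.mul_div_cancel_left _ (hN0 k)
        have h2 : (j + 1) % N k = 0 := by rw [hj1]; exact Nat.mul_mod_right _ _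
        rw [h1, h2, s0]
        have := r2 (j % N k)
        rwa [hj', r1] at this
  let M : ℕ → ℕ := fun k => ∏ i ∈ Finset.range k, N i
  have hM0 : ∀ k, 0 < M k := fun k => Finset.prod_pos fun i _ => hN0 i
  have hMS : ∀ k, M (k + 1) = M k * N k := fun k => Finset.prod_range_succ _ _
  have hFx : ∀ k, F k 0 = x := by
    intro k
    induction k with
    | zero => simp [hF0]
    | succ k ih =>
      rw [hFS]; simp only [Nat.zero_div, Nat.zero_mod]
      rw [(hR k _ _ (hlink k 0)).1, ih]
  have hFy : ∀ k, F k (M k) = y := by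
    intro k
    induction k with
    | zero => simp [hF0, M]
    | succ k ih =>
      rw [hFS, hMS, Nat.mul_div_cancel _ (hN0 k), Nat.mul_mod_left,
        (hR k _ _ (hlink k (M k))).1, ih]
  let f : ℕ → unitInterval → X := fun k t => F k ⌊(t : ℝ) * M k⌋₊
  have hf : ∀ k t, dist (f k t) (f (k + 1) t) ≤ (4 * ε) / 2 / 2 ^ k := by
    intro k t
    have h1 : ⌊(t : ℝ) * M (k + 1)⌋₊ / N k = ⌊(t : ℝ) * M k⌋₊ := by
      rw [← Nat.floor_div_natCast, hMS]
      congr 1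
      have := (Nat.cast_pos (α := ℝ)).2 (hN0 k)
      push_cast; field_simp
    have h2 := (hR k _ _ (hlink k ⌊(t : ℝ) * M k⌋₊)).2.2.2 (⌊(t : ℝ) * M (k + 1)⌋₊ % N k)
    simp only [f]
    rw [dist_comm, hFS, h1]
    refine h2.trans (le_of_eq ?_)
    simp only [e, one_div, inv_pow]
    field_simp; norm_num
  have hcau : ∀ t, CauchySeq fun k => f k t := fun t =>
    cauchySeq_of_le_geometric_two (fun k => hf k t)
  choose g hg using fun t => cauchySeq_tendsto_of_complete (hcau t)
  have hfg : ∀ k t, dist (f k t) (g t) ≤ 4 * e k := by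
    intro k t
    have := dist_le_of_le_geometric_two_of_tendsto (fun k => hf k t) (hg t) k
    refine this.trans (le_of_eq ?_)
    simp only [e, one_div, inv_pow]; field_simp
  have hfosc : ∀ k (s t : unitInterval), s ≤ t → (t : ℝ) - s < 1 / M k →
      dist (f k s) (f k t) ≤ e k := by
    intro k s t hst hd
    have hMp : (0 : ℝ) < M k := Nat.cast_pos.2 (hM0 k)
    have hd' : (t : ℝ) * M k < s * M k + 1 := by
      rw [lt_div_iff₀ hMp] at hd; linarith
    have hst' : (s : ℝ) * M k ≤ t * M k := mul_le_mul_of_nonneg_right hst hMp.le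
    have h1 : ⌊(s : ℝ) * M k⌋₊ ≤ ⌊(t : ℝ) * M k⌋₊ := Nat.floor_le_floor hst'
    have h2 : ⌊(t : ℝ) * M k⌋₊ ≤ ⌊(s : ℝ) * M k⌋₊ + 1 := by
      rw [← Nat.floor_add_one (mul_nonneg s.2.1 hMp.le)]
      exact Nat.floor_le_floor hd'.le
    simp only [f]
    rcases (show ⌊(t : ℝ) * M k⌋₊ = ⌊(s : ℝ) * M k⌋₊ ∨
      ⌊(t : ℝ) * M k⌋₊ = ⌊(s : ℝ) * M k⌋₊ + 1 by omega) with h | h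
    · rw [h, dist_self]; exact (he k).le
    · rw [h]
      obtain ⟨S, -, ha, hb, hS⟩ := hlink k ⌊(s : ℝ) * M k⌋₊
      exact hS _ ha _ hb
  have hosc : ∀ k (s t : unitInterval), s ≤ t → (t : ℝ) - s < 1 / M k →
      dist (g s) (g t) ≤ 9 * e k := by
    intro k s t hst hd
    have h1 := hfg k s
    have h2 := hfg k t
    have h3 := hfosc k s t hst hd
    have h4 := dist_triangle4 (g s) (f k s) (f k t) (g t)
    rw [dist_comm (g s) (f k s)] at h4
    linarith
  have hgc : Continuous g := by
    rw [Metric.continuous_iff]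
    intro s δ hδ
    have hlim : Tendsto (fun k => 9 * e k) atTop (𝓝 0) := by
      have : Tendsto (fun k : ℕ => 9 * (ε * (1 / 2 : ℝ) ^ k)) atTop (𝓝 (9 * (ε * 0))) :=
        ((tendsto_pow_atTop_nhds_zero_of_lt_one (by norm_num) (by norm_num)).const_mul _).const_mul
          _
      simpa only [mul_zero, e] using this
    obtain ⟨k, hk⟩ := (hlim.eventually_lt_const hδ).exists
    refine ⟨1 / M k, by have := hM0 k; positivity, fun t ht => ?_⟩
    rw [Subtype.dist_eq, Real.dist_eq] at ht
    have ht' := abs_lt.1 ht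
    rcases le_total s t with h | h
    · rw [dist_comm]; exact (hosc k s t h (by linarith)).trans_lt hk
    · exact (hosc k t s h (by linarith)).trans_lt hk
  have hg0 : g 0 = x := tendsto_nhds_unique (hg 0) (by simp [f, hFx])
  have hg1 : g 1 = y := tendsto_nhds_unique (hg 1) (by simp [f, hFy])
  refine ⟨⟨⟨g, hgc⟩, hg0, hg1⟩, fun t => ?_⟩
  change dist (g t) x ≤ 5 * ε
  have h1 := hfg 0 t
  have h2 : dist (f 0 t) x ≤ ε := by
    simp only [f, hF0]
    obtain ⟨S, -, ha, hb, hS⟩ := hxy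
    split_ifs
    · rw [dist_self]; exact hε.le
    · exact hS _ hb _ ha
  have h3 : e 0 = ε := by simp [e]
  rw [h3] at h1
  have h4 := dist_triangle_left (g t) x (f 0 t)
  linarith

theorem locallyPathConnectedSpace_of_compact_locallyConnected {X : Type*} [MetricSpace X]
    [CompactSpace X] [LocallyConnectedSpace X] : LocallyPathConnectedSpace X := by
  rw [locallyPathConnectedSpace_iff_pathComponentIn_mem_nhds]
  intro x u hu hxu
  obtain ⟨r, hr, hru⟩ := Metric.isOpen_iff.1 hu x hxu
  obtain ⟨V, hVo, hVc, hxV, -, hVd⟩ := exists_connected_open_small x (show 0 < r / 6 by linarith)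
  refine mem_of_superset (hVo.mem_nhds hxV) fun y hy => ?_
  obtain ⟨γ, hγ⟩ := Linked.exists_path (show 0 < r / 6 by linarith) ⟨V, hVc, hxV, hy, hVd⟩
  exact ⟨γ, fun t => hru (mem_ball.2 ((hγ t).trans_lt (by linarith)))⟩

/-! ## Arcs -/

/-- `A` is an arc with end points `a` and `b`. -/
def IsArc {X : Type*} [TopologicalSpace X] (A : Set X) (a b : X) : Prop :=
  ∃ (l r : ℝ) (f : ℝ → X), l < r ∧ ContinuousOn f (Icc l r) ∧ InjOn f (Icc l r) ∧
    f l = a ∧ f r = b ∧ f '' Icc l r = A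

/-- A continuous monotone image of an interval is the image of an interval under an injective
map. -/
theorem isArc_of_factor {X : Type*} [TopologicalSpace X] {g : ℝ → X} (hg : Continuous g)
    {φ : ℝ → ℝ} (hφ : Continuous φ) (hmono : MonotoneOn φ (Icc 0 1))
    (hiff : ∀ s ∈ Icc (0 : ℝ) 1, ∀ t ∈ Icc (0 : ℝ) 1, φ s = φ t ↔ g s = g t) (h01 : g 0 ≠ g 1) :
    IsArc (g '' Icc 0 1) (g 0) (g 1) := by
  have z0 : (0 : ℝ) ∈ Icc (0 : ℝ) 1 := by simp
  have z1 : (1 : ℝ) ∈ Icc (0 : ℝ) 1 := by simp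
  have himg : φ '' Icc 0 1 = Icc (φ 0) (φ 1) := by
    apply Subset.antisymm
    · rintro _ ⟨t, ht, rfl⟩
      exact ⟨hmono z0 ht ht.1, hmono ht z1 ht.2⟩
    · exact intermediate_value_Icc zero_le_one hφ.continuousOn
  have hinv : ∀ y, ∃ t, y ∈ Icc (φ 0) (φ 1) → t ∈ Icc (0 : ℝ) 1 ∧ φ t = y := by
    intro y
    by_cases hy : y ∈ Icc (φ 0) (φ 1)
    · obtain ⟨t, ht, rfl⟩ := himg ▸ hy
      exact ⟨t, fun _ => ⟨ht, rfl⟩⟩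
    · exact ⟨0, fun h => absurd h hy⟩
  choose ψ hψ using hinv
  have hψφ : ∀ t ∈ Icc (0 : ℝ) 1, g (ψ (φ t)) = g t := by
    intro t ht
    have h := hψ (φ t) (himg ▸ mem_image_of_mem φ ht)
    exact (hiff _ h.1 _ ht).1 h.2
  refine ⟨φ 0, φ 1, g ∘ ψ, ?_, ?_, ?_, hψφ 0 z0, hψφ 1 z1, ?_⟩
  · exact lt_of_le_of_ne (hmono z0 z1 zero_le_one) fun h => h01 ((hiff _ z0 _ z1).1 h)
  · rw [continuousOn_iff_isClosed]
    intro Z hZ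
    refine ⟨φ '' (g ⁻¹' Z ∩ Icc 0 1),
      ((isCompact_Icc.inter_left (hZ.preimage hg)).image hφ).isClosed, ?_⟩
    ext y
    constructor
    · rintro ⟨h1, h2⟩
      exact ⟨⟨ψ y, ⟨h1, (hψ y h2).1⟩, (hψ y h2).2⟩, h2⟩
    · rintro ⟨⟨t, ⟨h1, h2⟩, rfl⟩, h3⟩
      refine ⟨?_, h3⟩
      change g (ψ (φ t)) ∈ Z
      rw [hψφ t h2]; exact h1
  · intro y hy z hz hyz
    rw [← (hψ y hy).2, ← (hψ z hz).2]
    exact (hiff _ (hψ y hy).1 _ (hψ z hz).1).2 hyz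
  · rw [← himg, ← image_comp]
    exact image_congr fun t ht => hψφ t ht

theorem isArc_of_monotone_fibers {X : Type*} [MetricSpace X] {g : ℝ → X} (hg : Continuous g)
    (hfib : ∀ s u t, 0 ≤ s → s ≤ u → u ≤ t → t ≤ 1 → g s = g t → g u = g s) (h01 : g 0 ≠ g 1) :
    IsArc (g '' Icc 0 1) (g 0) (g 1) := by
  let H : ℝ → ℝ → ℝ → ℝ := fun a t u => min 1 (dist (g a) (g (max a (min t u))))
  let m : ℝ → ℝ → ℝ := fun a t => sSup (H a t '' Icc 0 1)
  have hHc : ∀ a, Continuous (Function.uncurry (H a)) := by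
    intro a; simp only [H, Function.uncurry_def]; fun_prop
  have hmc : ∀ a, Continuous (m a) := fun a => isCompact_Icc.continuous_sSup (hHc a)
  have hH0 : ∀ a t u, 0 ≤ H a t u := fun a t u => le_min zero_le_one dist_nonneg
  have hH1 : ∀ a t u, H a t u ≤ 1 := fun a t u => min_le_left _ _
  have hbdd : ∀ a t, BddAbove (H a t '' Icc 0 1) := fun a t =>
    ⟨1, by rintro _ ⟨u, -, rfl⟩; exact hH1 _ _ _⟩
  have hne : ∀ a t, (H a t '' Icc 0 1).Nonempty := fun a t =>
    ⟨_, mem_image_of_mem _ (show (0 : ℝ) ∈ Icc (0 : ℝ) 1 by simp)⟩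
  have hle : ∀ a t, ∀ u ∈ Icc (0 : ℝ) 1, H a t u ≤ m a t := fun a t u hu =>
    le_csSup (hbdd a t) (mem_image_of_mem _ hu)
  have hm0 : ∀ a t, 0 ≤ m a t := fun a t => (hH0 a t 0).trans (hle a t 0 (by simp))
  have hm1 : ∀ a t, m a t ≤ 1 := fun a t => csSup_le (hne a t) (by
    rintro _ ⟨u, -, rfl⟩; exact hH1 _ _ _)
  have hmono : ∀ a, MonotoneOn (m a) (Icc 0 1) := by
    intro a s hs t ht hst
    apply csSup_le (hne a s)
    rintro _ ⟨u, hu, rfl⟩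
    have h1 : H a s u = H a t (min s u) := by
      simp only [H]; rw [min_eq_right ((min_le_left s u).trans hst)]
    rw [h1]
    exact hle a t _ ⟨le_min hs.1 hu.1, (min_le_left _ _).trans hs.2⟩
  have hfac : ∀ a, ∀ s ∈ Icc (0 : ℝ) 1, ∀ t ∈ Icc (0 : ℝ) 1, s ≤ t → g s = g t →
      m a s = m a t := by
    intro a s hs t ht hst hgst
    apply le_antisymm (hmono a hs ht hst)
    apply csSup_le (hne a t)
    rintro _ ⟨u, hu, rfl⟩
    have hw : min t u ∈ Icc (0 : ℝ) 1 := ⟨le_min ht.1 hu.1, (min_le_left _ _).trans ht.2⟩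
    have hwt : min t u ≤ t := min_le_left _ _
    have key : H a t u = min 1 (dist (g a) (g (max a (min t u)))) := rfl
    generalize min t u = w at hw hwt key
    rw [key]
    rcases le_total w s with h | h
    · have := hle a s w hw
      simp only [H] at this
      rwa [min_eq_right h] at this
    rcases le_total w a with h2 | h2
    · rw [max_eq_left h2, dist_self]
      simpa using hm0 a s
    rw [max_eq_right h2]
    have hgw : g w = g s := hfib s w t hs.1 h hwt ht.2 hgst
    rcases le_total a s with h3 | h3
    · have := hle a s s hs
      simp only [H] at this
      rwa [min_self, max_eq_right h3, ← hgw] at this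
    · have : g a = g s := hfib s a t hs.1 h3 (h2.trans hwt) ht.2 hgst
      rw [hgw, this, dist_self]
      simpa using hm0 a s
  have hsep : ∀ s ∈ Icc (0 : ℝ) 1, ∀ t ∈ Icc (0 : ℝ) 1, s ≤ t → g s ≠ g t →
      ∃ q : ℚ, m q s < m q t := by
    intro s hs t ht hst hgst
    have hst' : s < t := lt_of_le_of_ne hst fun h => hgst (by rw [h])
    have hev : ∀ᶠ a in 𝓝[>] s, g a ≠ g t :=
      (hg.continuousAt.eventually_ne hgst).filter_mono nhdsWithin_le_nhds
    obtain ⟨b, hb, hb'⟩ := (mem_nhdsGT_iff_exists_Ioo_subset' hst').1 hev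
    obtain ⟨q, hq1, hq2⟩ := exists_rat_btwn (show s < min b t from lt_min hb hst')
    refine ⟨q, ?_⟩
    have h1 : m q s ≤ 0 := by
      apply csSup_le (hne _ _)
      rintro _ ⟨u, -, rfl⟩
      simp only [H]
      rw [max_eq_left ((min_le_left _ _).trans hq1.le), dist_self]
      exact min_le_right _ _
    have h2 := hle q t t ht
    simp only [H] at h2
    rw [min_self, max_eq_right (hq2.le.trans (min_le_right _ _))] at h2
    have h3 : 0 < dist (g q) (g t) :=
      dist_pos.2 (hb' ⟨hq1, hq2.trans_le (min_le_left _ _)⟩)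
    exact h1.trans_lt ((lt_min one_pos h3).trans_le h2)
  let e := Denumerable.eqv ℚ
  let φ : ℝ → ℝ := fun t => ∑' n : ℕ, (1 / 2 : ℝ) ^ n * m (e.symm n) t
  have hbd : ∀ n t, ‖(1 / 2 : ℝ) ^ n * m (e.symm n) t‖ ≤ (1 / 2 : ℝ) ^ n := by
    intro n t
    rw [Real.norm_of_nonneg (mul_nonneg (by positivity) (hm0 _ _))]
    exact mul_le_of_le_one_right (by positivity) (hm1 _ _)
  have hsum : ∀ t, Summable fun n : ℕ => (1 / 2 : ℝ) ^ n * m (e.symm n) t := fun t =>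
    Summable.of_norm_bounded summable_geometric_two fun n => hbd n t
  have hφ : Continuous φ :=
    continuous_tsum (fun n => continuous_const.mul (hmc _)) summable_geometric_two hbd
  have hφm : MonotoneOn φ (Icc 0 1) := by
    intro s hs t ht hst
    exact (hsum s).tsum_le_tsum
      (fun n => mul_le_mul_of_nonneg_left (hmono _ hs ht hst) (by positivity)) (hsum t)
  have hle : ∀ s ∈ Icc (0 : ℝ) 1, ∀ t ∈ Icc (0 : ℝ) 1, s ≤ t → (φ s = φ t ↔ g s = g t) := by
    intro s hs t ht hst
    constructor
    · intro h
      by_contra hne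
      obtain ⟨q, hq⟩ := hsep s hs t ht hst hne
      refine h.not_lt ?_
      refine Summable.tsum_lt_tsum (i := e q) (f := fun n => (1 / 2 : ℝ) ^ n * m (e.symm n) s)
        (fun n => mul_le_mul_of_nonneg_left (hmono _ hs ht hst) (by positivity)) ?_
        (hsum s) (hsum t)
      rw [e.symm_apply_apply]
      exact mul_lt_mul_of_pos_left hq (by positivity)
    · intro h
      exact tsum_congr fun n => by rw [hfac _ s hs t ht hst h]
  refine isArc_of_factor hg hφ hφm (fun s hs t ht => ?_) h01
  rcases le_total s t with h | h
  · exact hle s hs t ht h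
  · rw [eq_comm, hle t ht s hs h, eq_comm]

/-- Every path between distinct points contains an arc. -/
theorem Path.exists_isArc {X : Type*} [MetricSpace X] {a b : X} (p : Path a b) (hab : a ≠ b) :
    ∃ A ⊆ range p, IsArc A a b := by
  let γ : ℝ → X := p.extend
  have hγ : Continuous γ := p.continuous_extend
  have hγ0 : γ 0 = a := p.extend_zero
  have hγ1 : γ 1 = b := p.extend_one
  let S : Set (Set ℝ) := {F | IsClosed F ∧ F ⊆ Icc 0 1 ∧ 0 ∈ F ∧ 1 ∈ F ∧
    ∀ s ∈ F, ∀ t ∈ F, s < t → F ∩ Ioo s t = ∅ → γ s = γ t}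
  have hI : Icc (0 : ℝ) 1 ∈ S := by
    refine ⟨isClosed_Icc, subset_rfl, by simp, by simp, fun s hs t ht hst h => ?_⟩
    exfalso
    refine (eq_empty_iff_forall_notMem.1 h) ((s + t) / 2) ⟨⟨?_, ?_⟩, ?_, ?_⟩ <;>
      linarith [hs.1, ht.2]
  obtain ⟨F, -, hFS, hFmin⟩ := zorn_superset_nonempty S (by
    intro c hc hchain hcne
    refine ⟨⋂₀ c, ⟨isClosed_sInter fun F hF => (hc hF).1, ?_, fun F hF => (hc hF).2.2.1,
      fun F hF => (hc hF).2.2.2.1, ?_⟩, fun F hF => sInter_subset_of_mem hF⟩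
    · obtain ⟨F, hF⟩ := hcne
      exact (sInter_subset_of_mem hF).trans (hc hF).2.1
    intro s hs t ht hst hgap
    have near : ∀ δ > 0, ∃ s' t', |s' - s| ≤ δ ∧ |t' - t| ≤ δ ∧ γ s' = γ t' := by
      intro δ' hδ'
      obtain ⟨δ, hδ, hδδ, hδst⟩ : ∃ δ > 0, δ ≤ δ' ∧ δ < (t - s) / 2 := by
        refine ⟨min δ' ((t - s) / 4), lt_min hδ' (by linarith), min_le_left _ _, ?_⟩
        exact (min_le_right _ _).trans_lt (by linarith)
      have : Nonempty c := hcne.to_subtype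
      obtain ⟨⟨G, hG⟩, hGe⟩ := (isCompact_Icc (a := s + δ) (b := t - δ)).elim_directed_family_closed
        (fun G : c => (G : Set ℝ)) (fun G => (hc G.2).1) (by
          rw [← sInter_eq_iInter, ← subset_empty_iff, ← hgap]
          rintro u ⟨hu, hu'⟩
          exact ⟨hu', by linarith [hu.1], by linarith [hu.2]⟩)
          (by
            rintro ⟨G1, h1⟩ ⟨G2, h2⟩
            rcases hchain.total h1 h2 with h | h
            · exact ⟨⟨G1, h1⟩, subset_rfl, h⟩
            · exact ⟨⟨G2, h2⟩, h, subset_rfl⟩)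
      obtain ⟨s', hs', hs'm⟩ := ((isCompact_Icc (a := s) (b := s + δ)).inter_left
        (hc hG).1).exists_isGreatest ⟨s, hs G hG, by simp [hδ.le]⟩
      obtain ⟨t', ht', ht'm⟩ := ((isCompact_Icc (a := t - δ) (b := t)).inter_left
        (hc hG).1).exists_isLeast ⟨t, ht G hG, by simp [hδ.le]⟩
      refine ⟨s', t', ?_, ?_, (hc hG).2.2.2.2 s' hs'.1 t' ht'.1 ?_ ?_⟩
      · rw [abs_le]; constructor <;> linarith [hs'.2.1, hs'.2.2]
      · rw [abs_le]; constructor <;> linarith [ht'.2.1, ht'.2.2]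
      · linarith [hs'.2.2, ht'.2.1]
      · rw [eq_empty_iff_forall_notMem]
        rintro u ⟨huG, hu1, hu2⟩
        rcases le_total u (s + δ) with h | h
        · exact absurd (hs'm ⟨huG, by linarith [hs'.2.1], h⟩) (not_le.2 hu1)
        rcases le_total (t - δ) u with h' | h'
        · exact absurd (ht'm ⟨huG, h', by linarith [ht'.2.2]⟩) (not_le.2 hu2)
        exact (eq_empty_iff_forall_notMem.1 hGe) u ⟨⟨h, h'⟩, huG⟩
    by_contra hne
    have hpos : 0 < dist (γ s) (γ t) / 2 := half_pos (dist_pos.2 hne)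
    obtain ⟨d1, hd1, h1⟩ := Metric.continuous_iff.1 hγ s _ hpos
    obtain ⟨d2, hd2, h2⟩ := Metric.continuous_iff.1 hγ t _ hpos
    obtain ⟨s', t', hs', ht', he⟩ := near (min d1 d2 / 2) (half_pos (lt_min hd1 hd2))
    have e1 := h1 s' (by
      rw [Real.dist_eq]; have := min_le_left d1 d2; have := lt_min hd1 hd2; linarith)
    have e2 := h2 t' (by
      rw [Real.dist_eq]; have := min_le_right d1 d2; have := lt_min hd1 hd2; linarith)
    rw [he] at e1
    have := dist_triangle_left (γ s) (γ t) (γ t')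
    linarith) _ hI
  obtain ⟨hFc, hF01, hF0, hF1, hFgap⟩ := hFS
  have hloop : ∀ s ∈ F, ∀ t ∈ F, s < t → γ s = γ t → F ∩ Ioo s t = ∅ := by
    intro s hs t ht hst hgst
    have hsub : F \ Ioo s t ∈ S := by
      refine ⟨hFc.sdiff isOpen_Ioo, sdiff_subset.trans hF01,
        ⟨hF0, fun h => absurd (hF01 hs).1 (not_le.2 h.1)⟩,
        ⟨hF1, fun h => absurd (hF01 ht).2 (not_le.2 h.2)⟩, ?_⟩
      rintro p ⟨hp, hp'⟩ q ⟨hq, hq'⟩ hpq hgap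
      by_cases hemp : F ∩ Ioo p q = ∅
      · exact hFgap p hp q hq hpq hemp
      obtain ⟨u, huF, hu1, hu2⟩ := nonempty_iff_ne_empty.2 hemp
      have hust : u ∈ Ioo s t := by
        by_contra h
        exact (eq_empty_iff_forall_notMem.1 hgap) u ⟨⟨huF, h⟩, hu1, hu2⟩
      have hps : p ≤ s := not_lt.1 fun h => hp' ⟨h, hu1.trans hust.2⟩
      have htq : t ≤ q := not_lt.1 fun h => hq' ⟨hust.1.trans hu2, h⟩
      have hps' : p = s := by
        by_contra h
        exact (eq_empty_iff_forall_notMem.1 hgap) s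
          ⟨⟨hs, fun h => lt_irrefl _ h.1⟩, lt_of_le_of_ne hps h, hst.trans_le htq⟩
      have htq' : t = q := by
        by_contra h
        exact (eq_empty_iff_forall_notMem.1 hgap) t
          ⟨⟨ht, fun h => lt_irrefl _ h.2⟩, hps.trans_lt hst, lt_of_le_of_ne htq h⟩
      rw [hps', ← htq', hgst]
    rw [eq_empty_iff_forall_notMem]
    rintro u ⟨hu, hu'⟩
    exact (hFmin hsub sdiff_subset hu).2 hu'
  have hlo : ∀ t : ℝ, ∃ l, 0 ≤ t → IsGreatest (F ∩ Icc 0 t) l := by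
    intro t
    by_cases ht : 0 ≤ t
    · obtain ⟨l, hl⟩ := ((isCompact_Icc (a := (0 : ℝ)) (b := t)).inter_left
        hFc).exists_isGreatest ⟨0, hF0, by simp [ht]⟩
      exact ⟨l, fun _ => hl⟩
    · exact ⟨0, fun h => absurd h ht⟩
  choose lo hlo using hlo
  have lo_mem : ∀ t, 0 ≤ t → lo t ∈ F := fun t ht => (hlo t ht).1.1
  have lo_le : ∀ t, 0 ≤ t → lo t ≤ t := fun t ht => (hlo t ht).1.2.2
  have le_lo : ∀ t, 0 ≤ t → ∀ u ∈ F, u ≤ t → u ≤ lo t := fun t ht u hu hut =>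
    (hlo t ht).2 ⟨hu, (hF01 hu).1, hut⟩
  have lo_eq : ∀ t ∈ F, lo t = t := fun t ht =>
    le_antisymm (lo_le t (hF01 ht).1) (le_lo t (hF01 ht).1 t ht le_rfl)
  have lo_mono : ∀ s t, 0 ≤ s → s ≤ t → lo s ≤ lo t := fun s t hs hst =>
    le_lo t (hs.trans hst) _ (lo_mem s hs) ((lo_le s hs).trans hst)
  have hcont : ContinuousOn (fun t => γ (lo t)) (Icc 0 1) := by
    rw [Metric.continuousOn_iff]
    intro t ht ε hε
    by_cases htF : t ∈ F
    · obtain ⟨δ, hδ, hδγ⟩ := Metric.continuous_iff.1 hγ t ε hε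
      have hball : ∀ v, |v - t| < δ → dist (γ v) (γ t) < ε := fun v hv =>
        hδγ v (by rwa [Real.dist_eq])
      by_cases hacc : ∃ r ∈ F, t - δ < r ∧ r < t
      · obtain ⟨r, hrF, hr1, hr2⟩ := hacc
        refine ⟨min δ (t - r), lt_min hδ (by linarith), fun s hs hst => ?_⟩
        rw [Real.dist_eq] at hst
        have h1 := abs_lt.1 (hst.trans_le (min_le_left _ _))
        have h2 := abs_lt.1 (hst.trans_le (min_le_right _ _))
        rw [lo_eq t htF]
        apply hball
        have := le_lo s hs.1 r hrF (by linarith)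
        have := lo_le s hs.1
        rw [abs_lt]; constructor <;> linarith
      · refine ⟨δ, hδ, fun s hs hst => ?_⟩
        rw [Real.dist_eq] at hst
        have h1 := abs_lt.1 hst
        rw [lo_eq t htF]
        rcases le_total t s with h | h
        · apply hball
          have := le_lo s hs.1 t htF h
          have := lo_le s hs.1
          rw [abs_lt]; constructor <;> linarith
        · have hl := lo_le s hs.1
          rcases eq_or_lt_of_le (hl.trans h) with h2 | h2
          · rw [h2, dist_self]; exact hε
          · rw [hFgap _ (lo_mem s hs.1) t htF h2, dist_self]
            · exact hε
            rw [eq_empty_iff_forall_notMem]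
            rintro u ⟨huF, hu1, hu2⟩
            rcases le_total u s with h3 | h3
            · exact absurd (le_lo s hs.1 u huF h3) (not_le.2 hu1)
            · exact hacc ⟨u, huF, by linarith, hu2⟩
    · obtain ⟨δ, hδ, hδF⟩ := Metric.isOpen_iff.1 hFc.isOpen_compl t htF
      refine ⟨δ, hδ, fun s hs hst => ?_⟩
      have hst' := abs_lt.1 (by rwa [Real.dist_eq] at hst : |s - t| < δ)
      have hno : ∀ u ∈ F, ¬ |u - t| < δ := fun u hu h =>
        hδF (show u ∈ ball t δ by rwa [mem_ball, Real.dist_eq]) hu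
      have : lo s = lo t := by
        apply le_antisymm
        · apply le_lo t ht.1 _ (lo_mem s hs.1)
          by_contra h
          apply hno _ (lo_mem s hs.1)
          have := lo_le s hs.1
          rw [abs_lt]; constructor <;> linarith
        · apply le_lo s hs.1 _ (lo_mem t ht.1)
          by_contra h
          apply hno _ (lo_mem t ht.1)
          have := lo_le t ht.1
          rw [abs_lt]; constructor <;> linarith
      rw [this, dist_self]; exact hε
  let g : ℝ → X := fun t => γ (lo (projIcc 0 1 zero_le_one t))
  have hg : Continuous g :=
    hcont.comp_continuous (continuous_subtype_val.comp continuous_projIcc)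
      fun t => (projIcc 0 1 _ t).2
  have hgI : ∀ t ∈ Icc (0 : ℝ) 1, g t = γ (lo t) := by
    intro t ht
    simp only [g, projIcc_of_mem zero_le_one ht]
  have hg0 : g 0 = a := by rw [hgI 0 (by simp), lo_eq 0 hF0, hγ0]
  have hg1 : g 1 = b := by rw [hgI 1 (by simp), lo_eq 1 hF1, hγ1]
  refine ⟨g '' Icc 0 1, ?_, ?_⟩
  · rintro _ ⟨t, ht, rfl⟩
    rw [hgI t ht, ← p.extend_range]
    exact mem_range_self _
  · rw [← hg0, ← hg1]
    apply isArc_of_monotone_fibers hg _ (by rwa [hg0, hg1])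
    intro s u t hs hsu hut ht h
    have hsI : s ∈ Icc (0 : ℝ) 1 := ⟨hs, hsu.trans (hut.trans ht)⟩
    have huI : u ∈ Icc (0 : ℝ) 1 := ⟨hs.trans hsu, hut.trans ht⟩
    have htI : t ∈ Icc (0 : ℝ) 1 := ⟨hs.trans (hsu.trans hut), ht⟩
    rw [hgI s hsI, hgI t htI] at h
    rw [hgI s hsI, hgI u huI]
    have h1 := lo_mono s u hs hsu
    have h2 := lo_mono u t (hs.trans hsu) hut
    rcases eq_or_lt_of_le (h1.trans h2) with he | hl
    · rw [le_antisymm (he ▸ h2) h1]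
    have hgap := hloop _ (lo_mem s hsI.1) _ (lo_mem t htI.1) hl h
    rcases eq_or_lt_of_le h1 with h1 | h1
    · rw [h1]
    rcases eq_or_lt_of_le h2 with h2 | h2
    · rw [h2, h]
    exact absurd ⟨lo_mem u huI.1, h1, h2⟩ ((eq_empty_iff_forall_notMem.1 hgap) (lo u))

theorem IsArc.exists_param {X : Type*} [TopologicalSpace X] {A : Set X} {a b : X}
    (h : IsArc A a b) {l r : ℝ} (hlr : l < r) :
    ∃ f : ℝ → X, Continuous f ∧ InjOn f (Icc l r) ∧ f l = a ∧ f r = b ∧ f '' Icc l r = A := by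
  obtain ⟨l0, r0, f, h0, hc, hi, rfl, rfl, rfl⟩ := h
  let φ : ℝ → ℝ := fun t => l0 + (r0 - l0) / (r - l) * (t - l)
  have hpos : 0 < (r0 - l0) / (r - l) := div_pos (by linarith) (by linarith)
  have hφl : φ l = l0 := by simp [φ]
  have hφr : φ r = r0 := by
    have : r - l ≠ 0 := by linarith
    simp only [φ]; field_simp; ring
  have hφm : StrictMono φ := fun s t hst => by
    have := mul_lt_mul_of_pos_left (sub_lt_sub_right hst l) hpos
    simp only [φ]; linarith
  have hφc : Continuous φ := by fun_prop
  have himg : φ '' Icc l r = Icc l0 r0 := by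
    apply Subset.antisymm
    · rintro _ ⟨t, ht, rfl⟩
      exact ⟨hφl ▸ hφm.monotone ht.1, hφr ▸ hφm.monotone ht.2⟩
    · have := intermediate_value_Icc hlr.le hφc.continuousOn
      rwa [hφl, hφr] at this
  have hcomp : ContinuousOn (f ∘ φ) (Icc l r) :=
    hc.comp hφc.continuousOn fun t ht => himg ▸ mem_image_of_mem φ ht
  have hext : EqOn (IccExtend hlr.le ((Icc l r).domRestrict (f ∘ φ))) (f ∘ φ) (Icc l r) :=
    fun t ht => by rw [IccExtend_of_mem _ _ ht]; rfl
  refine ⟨IccExtend hlr.le ((Icc l r).domRestrict (f ∘ φ)), hcomp.domRestrict.Icc_extend',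
    ?_, ?_, ?_, ?_⟩
  · rw [hext.injOn_iff]
    exact hi.comp hφm.injective.injOn fun t ht => himg ▸ mem_image_of_mem φ ht
  · rw [hext (left_mem_Icc.2 hlr.le), Function.comp, hφl]
  · rw [hext (right_mem_Icc.2 hlr.le), Function.comp, hφr]
  · rw [hext.image_eq, image_comp, himg]

theorem IsArc.isCompact {X : Type*} [TopologicalSpace X] {A : Set X} {a b : X}
    (h : IsArc A a b) : IsCompact A := by
  obtain ⟨l, r, f, h0, hc, hi, rfl, rfl, rfl⟩ := h
  exact isCompact_Icc.image_of_continuousOn hc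

theorem IsArc.isPreconnected {X : Type*} [TopologicalSpace X] {A : Set X} {a b : X}
    (h : IsArc A a b) : IsPreconnected A := by
  obtain ⟨l, r, f, h0, hc, hi, rfl, rfl, rfl⟩ := h
  exact isPreconnected_Icc.image _ hc

theorem IsArc.left_mem {X : Type*} [TopologicalSpace X] {A : Set X} {a b : X}
    (h : IsArc A a b) : a ∈ A := by
  obtain ⟨l, r, f, h0, hc, hi, rfl, rfl, rfl⟩ := h
  exact mem_image_of_mem f (left_mem_Icc.2 h0.le)

theorem IsArc.right_mem {X : Type*} [TopologicalSpace X] {A : Set X} {a b : X}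
    (h : IsArc A a b) : b ∈ A := by
  obtain ⟨l, r, f, h0, hc, hi, rfl, rfl, rfl⟩ := h
  exact mem_image_of_mem f (right_mem_Icc.2 h0.le)

theorem IsArc.ne {X : Type*} [TopologicalSpace X] {A : Set X} {a b : X}
    (h : IsArc A a b) : a ≠ b := by
  obtain ⟨l, r, f, h0, hc, hi, rfl, rfl, rfl⟩ := h
  exact fun h => h0.ne (hi (left_mem_Icc.2 h0.le) (right_mem_Icc.2 h0.le) h)

theorem IsArc.symm {X : Type*} [TopologicalSpace X] {A : Set X} {a b : X}
    (h : IsArc A a b) : IsArc A b a := by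
  obtain ⟨l, r, f, h0, hc, hi, rfl, rfl, rfl⟩ := h
  have himg : Neg.neg '' Icc (-r) (-l) = Icc l r := by simp
  have hmaps : MapsTo Neg.neg (Icc (-r) (-l)) (Icc l r) := by
    rw [← himg]; exact mapsTo_image _ _
  refine ⟨-r, -l, f ∘ Neg.neg, neg_lt_neg h0, hc.comp continuous_neg.continuousOn hmaps,
    hi.comp neg_injective.injOn hmaps, by simp, by simp, by rw [image_comp, himg]⟩

theorem IsArc.concat {X : Type*} [TopologicalSpace X] {A B : Set X} {a b c : X}
    (hA : IsArc A a b) (hB : IsArc B b c) (hAB : A ∩ B ⊆ {b}) : IsArc (A ∪ B) a c := by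
  obtain ⟨f, hf, hfi, rfl, rfl, rfl⟩ := hA.exists_param (show (0 : ℝ) < 1 by norm_num)
  obtain ⟨g, hg, hgi, hfg, rfl, rfl⟩ := hB.exists_param (show (1 : ℝ) < 2 by norm_num)
  let k : ℝ → X := fun t => if t ≤ 1 then f t else g t
  have hk : Continuous k := Continuous.if_le hf hg continuous_id continuous_const
    (fun t ht => by rw [ht, hfg])
  have hkf : ∀ t ≤ 1, k t = f t := fun t ht => if_pos ht
  have hkg : ∀ t, 1 ≤ t → k t = g t := by
    intro t ht
    rcases ht.eq_or_lt with h | h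
    · rw [hkf t h.ge, ← h, hfg]
    · exact if_neg (not_le.2 h)
  have hcross : ∀ s ∈ Icc (0 : ℝ) 1, ∀ t ∈ Icc (1 : ℝ) 2, f s = g t → s = t := by
    intro s hs t ht hst
    have h1 : f s = f 1 := hAB ⟨mem_image_of_mem f hs, hst ▸ mem_image_of_mem g ht⟩
    have h2 := hfi hs (by simp) h1
    have h3 := hgi ht (by simp) (show g t = g 1 by rw [← hst, h1, hfg])
    rw [h2, h3]
  refine ⟨0, 2, k, by norm_num, hk.continuousOn, ?_, hkf 0 (by norm_num), hkg 2 (by norm_num), ?_⟩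
  · intro s hs t ht hst
    rcases le_total s 1 with h | h <;> rcases le_total t 1 with h' | h'
    · rw [hkf s h, hkf t h'] at hst; exact hfi ⟨hs.1, h⟩ ⟨ht.1, h'⟩ hst
    · rw [hkf s h, hkg t h'] at hst; exact hcross s ⟨hs.1, h⟩ t ⟨h', ht.2⟩ hst
    · rw [hkg s h, hkf t h'] at hst; exact (hcross t ⟨ht.1, h'⟩ s ⟨h, hs.2⟩ hst.symm).symm
    · rw [hkg s h, hkg t h'] at hst; exact hgi ⟨h, hs.2⟩ ⟨h', ht.2⟩ hst
  · rw [← Icc_union_Icc_eq_Icc (show (0 : ℝ) ≤ 1 by norm_num) (show (1 : ℝ) ≤ 2 by norm_num),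
      image_union]
    congr 1
    · exact image_congr fun t ht => hkf t ht.2
    · exact image_congr fun t ht => hkg t ht.1

theorem IsArc.exists_subarc {X : Type*} [TopologicalSpace X] {A : Set X} {a b s t : X}
    (h : IsArc A a b) (hs : s ∈ A) (ht : t ∈ A) (hst : s ≠ t) : ∃ A' ⊆ A, IsArc A' s t := by
  obtain ⟨l, r, f, h0, hc, hi, rfl, rfl, rfl⟩ := h
  obtain ⟨u, hu, rfl⟩ := hs
  obtain ⟨v, hv, rfl⟩ := ht
  have key : ∀ u ∈ Icc l r, ∀ v ∈ Icc l r, u < v → ∃ A' ⊆ f '' Icc l r, IsArc A' (f u) (f v) := by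
    intro u hu v hv huv
    have hsub : Icc u v ⊆ Icc l r := Icc_subset_Icc hu.1 hv.2
    exact ⟨f '' Icc u v, image_mono hsub, u, v, f, huv, hc.mono hsub, hi.mono hsub, rfl, rfl, rfl⟩
  rcases lt_trichotomy u v with huv | huv | huv
  · exact key u hu v hv huv
  · exact absurd (congrArg f huv) hst
  · obtain ⟨A', h1, h2⟩ := key v hv u hu huv
    exact ⟨A', h1, h2.symm⟩

/-- An arc ending in a closed set contains a subarc meeting this set only at its end point. -/
theorem IsArc.exists_first_hit {X : Type*} [TopologicalSpace X] {A S : Set X} {a b : X}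
    (h : IsArc A a b) (hS : IsClosed S) (ha : a ∉ S) (hb : b ∈ S) :
    ∃ w ∈ S, ∃ A' ⊆ A, IsArc A' a w ∧ A' ∩ S = {w} := by
  obtain ⟨f, hf, hfi, rfl, rfl, rfl⟩ := h.exists_param (show (0 : ℝ) < 1 by norm_num)
  obtain ⟨t, ht, htm⟩ := (isCompact_Icc.inter_right (hS.preimage hf)).exists_isLeast
    ⟨(1 : ℝ), right_mem_Icc.2 zero_le_one, hb⟩
  have h0 : 0 < t := lt_of_le_of_ne ht.1.1 fun h => ha (h ▸ ht.2)
  have hsub : Icc 0 t ⊆ Icc (0 : ℝ) 1 := Icc_subset_Icc le_rfl ht.1.2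
  refine ⟨f t, ht.2, f '' Icc 0 t, image_mono hsub,
    ⟨0, t, f, h0, hf.continuousOn, hfi.mono hsub, rfl, rfl, rfl⟩, ?_⟩
  apply Subset.antisymm
  · rintro _ ⟨⟨u, hu, rfl⟩, huS⟩
    rw [mem_singleton_iff, le_antisymm hu.2 (htm ⟨hsub hu, huS⟩)]
  · rintro _ rfl
    exact ⟨mem_image_of_mem f (right_mem_Icc.2 h0.le), ht.2⟩

theorem IsArc.exists_between {X : Type*} [TopologicalSpace X] {A S T : Set X} {a b : X}
    (h : IsArc A a b) (hS : IsClosed S) (hT : IsClosed T) (hST : Disjoint S T) (ha : a ∈ S)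
    (hb : b ∈ T) :
    ∃ s ∈ S, ∃ t ∈ T, ∃ A' ⊆ A, IsArc A' s t ∧ A' ∩ S = {s} ∧ A' ∩ T = {t} := by
  obtain ⟨t, ht, A1, hA1, hA1a, hA1T⟩ :=
    h.exists_first_hit hT (disjoint_left.1 hST ha) hb
  obtain ⟨s, hs, A2, hA2, hA2a, hA2S⟩ :=
    hA1a.symm.exists_first_hit hS (disjoint_right.1 hST ht) ha
  refine ⟨s, hs, t, ht, A2, hA2.trans hA1, hA2a.symm, hA2S, ?_⟩
  apply Subset.antisymm
  · rw [← hA1T]; exact inter_subset_inter_left _ hA2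
  · rintro _ rfl; exact ⟨hA2a.left_mem, ht⟩

theorem IsOpen.exists_isArc {X : Type*} [MetricSpace X] [CompactSpace X]
    [LocallyConnectedSpace X] {U : Set X} (hU : IsOpen U) (hUc : IsPreconnected U) {a b : X}
    (ha : a ∈ U) (hb : b ∈ U) (hab : a ≠ b) : ∃ A ⊆ U, IsArc A a b := by
  have := locallyPathConnectedSpace_of_compact_locallyConnected (X := X)
  obtain ⟨p, hp⟩ := (hU.isConnected_iff_isPathConnected.1 ⟨⟨a, ha⟩, hUc⟩).joinedIn a ha b hb
  obtain ⟨A, hA, h⟩ := p.exists_isArc hab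
  exact ⟨A, hA.trans (range_subset_iff.2 hp), h⟩

/-! ## Jordan curves -/

theorem mem_circle1_iff (p : EuclideanSpace ℝ (Fin 2)) : p ∈ Circle1 ↔ p 0 ^ 2 + p 1 ^ 2 = 1 := by
  rw [Circle1, mem_sphere_zero_iff_norm, EuclideanSpace.norm_eq, Real.sqrt_eq_one]
  simp [Fin.sum_univ_two]

/-- Two arcs with common end points and no other common point form a Jordan curve. -/
theorem IsArc.isJordanCurve_union {X : Type*} [TopologicalSpace X] [T2Space X] {A B : Set X}
    {a b : X} (hA : IsArc A a b) (hB : IsArc B a b) (hAB : A ∩ B ⊆ {a, b}) :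
    IsJordanCurve (A ∪ B) := by
  have hab := hA.ne
  obtain ⟨f, hf, hfi, hfa, hfb, rfl⟩ := hA.exists_param (show (-1 : ℝ) < 1 by norm_num)
  obtain ⟨g, hg, hgi, hga, hgb, rfl⟩ := hB.exists_param (show (-1 : ℝ) < 1 by norm_num)
  let k : Circle1 → X := fun p => if 0 ≤ p.1 1 then f (p.1 0) else g (p.1 0)
  have hsq : ∀ p : Circle1, p.1 0 ^ 2 + p.1 1 ^ 2 = 1 := fun p => (mem_circle1_iff p.1).1 p.2
  have hmem : ∀ p : Circle1, p.1 0 ∈ Icc (-1 : ℝ) 1 := fun p =>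
    abs_le.1 ((sq_le_one_iff_abs_le_one _).1 (by nlinarith [hsq p, sq_nonneg (p.1 1)]))
  have hk : Continuous k := by
    refine Continuous.if_le (by fun_prop) (by fun_prop) continuous_const (by fun_prop) ?_
    intro p hp
    have h := hsq p
    rw [← hp] at h
    have : (p.1 0 - 1) * (p.1 0 + 1) = 0 := by linarith
    rcases mul_eq_zero.1 this with h | h
    · rw [sub_eq_zero.1 h, hfb, hgb]
    · rw [eq_neg_of_add_eq_zero_left h, hfa, hga]
  have hcross : ∀ p q : Circle1, 0 ≤ p.1 1 → q.1 1 < 0 → f (p.1 0) ≠ g (q.1 0) := by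
    intro p q hp hq h
    have hlt : q.1 0 ≠ -1 ∧ q.1 0 ≠ 1 := by
      have := hsq q
      constructor <;> intro h <;> rw [h] at this <;> nlinarith
    rcases hAB ⟨mem_image_of_mem f (hmem p), h ▸ mem_image_of_mem g (hmem q)⟩ with h1 | h1
    · exact hlt.1 (hgi (hmem q) (by simp) (by rw [← h, h1, hga]))
    · exact hlt.2 (hgi (hmem q) (by simp) (by rw [← h, h1, hgb]))
  have hext : ∀ p q : Circle1, p.1 0 = q.1 0 → p.1 1 = q.1 1 → p = q := by
    intro p q h0 h1
    ext i; fin_cases i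
    · exact h0
    · exact h1
  have hki : Function.Injective k := by
    intro p q hpq
    have hp2 := hsq p
    have hq2 := hsq q
    simp only [k] at hpq
    split_ifs at hpq with hp hq hq
    · have h0 := hfi (hmem p) (hmem q) hpq
      exact hext p q h0 ((sq_eq_sq₀ hp hq).1 (by rw [h0] at hp2; linarith))
    · exact absurd hpq (hcross p q hp (not_le.1 hq))
    · exact absurd hpq.symm (hcross q p hq (not_le.1 hp))
    · have h0 := hgi (hmem p) (hmem q) hpq
      refine hext p q h0 (neg_injective ((sq_eq_sq₀ ?_ ?_).1 ?_))
      · linarith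
      · linarith
      · rw [h0] at hp2; linarith
  have hsqrt : ∀ t ∈ Icc (-1 : ℝ) 1, 0 ≤ 1 - t ^ 2 := fun t ht => by nlinarith [ht.1, ht.2]
  have hrange : range k = f '' Icc (-1) 1 ∪ g '' Icc (-1) 1 := by
    apply Subset.antisymm
    · rintro _ ⟨p, rfl⟩
      simp only [k]
      split_ifs
      · exact Or.inl (mem_image_of_mem f (hmem p))
      · exact Or.inr (mem_image_of_mem g (hmem p))
    · have hfr : ∀ t ∈ Icc (-1 : ℝ) 1, f t ∈ range k := by
        intro t ht
        refine ⟨⟨!₂[t, √(1 - t ^ 2)], ?_⟩, ?_⟩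
        · rw [mem_circle1_iff]; simp [Real.sq_sqrt (hsqrt t ht)]
        · simp [k, Real.sqrt_nonneg]
      rintro _ (⟨t, ht, rfl⟩ | ⟨t, ht, rfl⟩)
      · exact hfr t ht
      · by_cases h : 0 < 1 - t ^ 2
        · refine ⟨⟨!₂[t, -√(1 - t ^ 2)], ?_⟩, ?_⟩
          · rw [mem_circle1_iff]; simp [Real.sq_sqrt (hsqrt t ht)]
          · simp [k, (Real.sqrt_pos.2 h)]
        · have : (t - 1) * (t + 1) = 0 := by nlinarith [hsqrt t ht]
          rcases mul_eq_zero.1 this with h | h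
          · rw [sub_eq_zero.1 h, hgb, ← hfb]; exact hfr _ (by simp)
          · rw [eq_neg_of_add_eq_zero_left h, hga, ← hfa]; exact hfr _ (by simp)
  have : CompactSpace Circle1 := isCompact_iff_compactSpace.1 (isCompact_sphere _ _)
  have hemb := (hk.isClosedEmbedding hki).isEmbedding
  rw [← hrange]
  exact ⟨hemb.toHomeomorph.symm⟩

theorem IsJordanCurve.exists_periodic {X : Type*} [TopologicalSpace X] {J : Set X}
    (h : IsJordanCurve J) : ∃ g : ℝ → X, Continuous g ∧ range g = J ∧
      ∀ s t, g s = g t ↔ ∃ k : ℤ, s - t = 2 * Real.pi * k := by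
  obtain ⟨e⟩ := h
  let c : ℝ → Circle1 := fun t => ⟨!₂[Real.cos t, Real.sin t], by rw [mem_circle1_iff]; simp⟩
  have hc : Continuous c := by
    refine Continuous.subtype_mk ?_ _
    refine (PiLp.continuous_toLp 2 _).comp (continuous_pi fun i => ?_)
    fin_cases i
    · exact Real.continuous_cos
    · exact Real.continuous_sin
  have hcs : Function.Surjective c := by
    rintro ⟨p, hp⟩
    rw [mem_circle1_iff] at hp
    let z : ℂ := ⟨p 0, p 1⟩
    have hz : ‖z‖ = 1 := by
      rw [Complex.norm_def, Complex.normSq_apply, Real.sqrt_eq_one]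
      simp only [z]; linarith
    have hz0 : z ≠ 0 := by rw [← norm_pos_iff, hz]; exact one_pos
    refine ⟨z.arg, ?_⟩
    ext i; fin_cases i
    · simp [c, Complex.cos_arg hz0, hz, z]
    · simp [c, Complex.sin_arg, hz, z]
  refine ⟨fun t => (e.symm (c t)).1, by fun_prop, ?_, fun s t => ?_⟩
  · apply Subset.antisymm
    · rintro _ ⟨t, rfl⟩; exact Subtype.prop _
    · intro x hx
      obtain ⟨t, ht⟩ := hcs (e ⟨x, hx⟩)
      exact ⟨t, by simp [ht]⟩
  · rw [← Real.Angle.angle_eq_iff_two_pi_dvd_sub, Subtype.val_inj, e.symm.injective.eq_iff]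
    constructor
    · intro h
      have h' := congrArg Subtype.val h
      refine Real.Angle.cos_sin_inj ?_ ?_
      · simpa [c] using congrArg (fun p : EuclideanSpace ℝ (Fin 2) => p 0) h'
      · simpa [c] using congrArg (fun p : EuclideanSpace ℝ (Fin 2) => p 1) h'
    · intro h
      have h1 : Real.cos s = Real.cos t := by simpa using congrArg Real.Angle.cos h
      have h2 : Real.sin s = Real.sin t := by simpa using congrArg Real.Angle.sin h
      simp [c, h1, h2]

theorem IsJordanCurve.isCompact {X : Type*} [TopologicalSpace X] {J : Set X}
    (h : IsJordanCurve J) : IsCompact J := by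
  obtain ⟨e⟩ := h
  have : CompactSpace Circle1 := isCompact_iff_compactSpace.1 (isCompact_sphere _ _)
  have := e.symm.compactSpace
  exact isCompact_iff_compactSpace.2 this

theorem IsJordanCurve.cycliclyConnected {X : Type*} [TopologicalSpace X] {J : Set X}
    (h : IsJordanCurve J) : CycliclyConnected J :=
  fun _ hx _ hy _ => ⟨J, subset_rfl, h, hx, hy⟩

theorem injOn_of_two_pi {X : Type*} {g : ℝ → X}
    (hg : ∀ s t, g s = g t ↔ ∃ k : ℤ, s - t = 2 * Real.pi * k) {S : Set ℝ}
    (hS : ∀ s ∈ S, ∀ t ∈ S, |s - t| < 2 * Real.pi) : InjOn g S := by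
  intro s hs t ht hst
  obtain ⟨k, hk⟩ := (hg s t).1 hst
  have h := hS s hs t ht
  have hpi := Real.two_pi_pos
  rw [hk, abs_mul, abs_of_pos hpi] at h
  have h1 : |(k : ℝ)| < 1 := by
    by_contra h'
    have := mul_le_mul_of_nonneg_left (not_lt.1 h') hpi.le
    linarith
  have h2 : k = 0 := Int.abs_lt_one_iff.1 (by exact_mod_cast h1)
  rw [h2] at hk
  simp at hk; linarith

/-- Two points cut a Jordan curve into two arcs. -/
theorem IsJordanCurve.exists_arcs {X : Type*} [TopologicalSpace X] {J : Set X}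
    (h : IsJordanCurve J) {x y : X} (hx : x ∈ J) (hy : y ∈ J) (hxy : x ≠ y) :
    ∃ A B : Set X, IsArc A x y ∧ IsArc B x y ∧ A ∪ B = J ∧ A ∩ B = {x, y} := by
  obtain ⟨g, hg, rfl, hgi⟩ := h.exists_periodic
  obtain ⟨s, rfl⟩ := hx
  obtain ⟨t', rfl⟩ := hy
  have hpi := Real.two_pi_pos
  have hmod : ∀ u, ∃ v, s ≤ v ∧ v < s + 2 * Real.pi ∧ g v = g u := by
    intro u
    have h1 := toIcoMod_mem_Ico hpi s u
    refine ⟨toIcoMod hpi s u, h1.1, h1.2, (hgi _ _).2 ⟨-toIcoDiv hpi s u, ?_⟩⟩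
    have := toIcoMod_sub_self hpi s u
    rw [this]; simp [mul_comm]
  obtain ⟨t, ht1, ht2, ht⟩ := hmod t'
  rw [← ht] at hxy ⊢
  have hst : s < t := lt_of_le_of_ne ht1 fun h => hxy (congrArg g h)
  have hper : g (s + 2 * Real.pi) = g s := (hgi _ _).2 ⟨1, by simp⟩
  refine ⟨g '' Icc s t, g '' Icc t (s + 2 * Real.pi), ⟨s, t, g, hst, hg.continuousOn, ?_, rfl, rfl,
    rfl⟩, IsArc.symm ⟨t, s + 2 * Real.pi, g, ht2, hg.continuousOn, ?_, rfl, hper, rfl⟩, ?_, ?_⟩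
  · refine injOn_of_two_pi hgi fun u hu v hv => ?_
    rw [abs_lt]; constructor <;> linarith [hu.1, hu.2, hv.1, hv.2]
  · refine injOn_of_two_pi hgi fun u hu v hv => ?_
    rw [abs_lt]; constructor <;> linarith [hu.1, hu.2, hv.1, hv.2]
  · rw [← image_union, Icc_union_Icc_eq_Icc ht1 ht2.le]
    refine Subset.antisymm (image_subset_range _ _) ?_
    rintro _ ⟨u, rfl⟩
    obtain ⟨v, hv1, hv2, hv⟩ := hmod u
    exact ⟨v, ⟨hv1, hv2.le⟩, hv⟩
  · apply Subset.antisymm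
    · rintro _ ⟨⟨u, hu, rfl⟩, ⟨v, hv, huv⟩⟩
      rcases hv.2.eq_or_lt with h | h
      · left; rw [← huv, h, hper]
      · right
        have hinj : InjOn g (Ico s (s + 2 * Real.pi)) := injOn_of_two_pi hgi fun u hu v hv => by
          rw [abs_lt]; constructor <;> linarith [hu.1, hu.2, hv.1, hv.2]
        have := hinj ⟨by linarith [hv.1], h⟩ ⟨hu.1, by linarith [hu.2]⟩ huv
        rw [mem_singleton_iff, show u = t by linarith [hu.2, hv.1]]
    · rintro _ (rfl | rfl)
      · exact ⟨⟨s, left_mem_Icc.2 ht1, rfl⟩, ⟨_, right_mem_Icc.2 ht2.le, hper⟩⟩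
      · exact ⟨⟨t, right_mem_Icc.2 ht1, rfl⟩, ⟨t, left_mem_Icc.2 ht2.le, rfl⟩⟩

/-! ## Cyclicly connected sets -/

theorem CycliclyConnected.exists_isMaximalCyclic {X : Type*} [TopologicalSpace X] {A : Set X}
    (hA : CycliclyConnected A) (hn : A.Nontrivial) : ∃ T, A ⊆ T ∧ IsMaximalCyclic T := by
  have hzorn : ∀ c ⊆ {B : Set X | CycliclyConnected B}, IsChain (· ⊆ ·) c → c.Nonempty →
      ∃ ub ∈ {B : Set X | CycliclyConnected B}, ∀ s ∈ c, s ⊆ ub := by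
    intro c hc hchain _
    refine ⟨⋃₀ c, ?_, fun s hs => subset_sUnion_of_mem hs⟩
    rintro x ⟨B, hB, hx⟩ y ⟨D, hD, hy⟩ hxy
    obtain ⟨E, hE, hxE, hyE⟩ : ∃ E ∈ c, x ∈ E ∧ y ∈ E := by
      rcases hchain.total hB hD with h | h
      · exact ⟨D, hD, h hx, hy⟩
      · exact ⟨B, hB, hx, h hy⟩
    obtain ⟨J, hJ, h⟩ := hc hE x hxE y hyE hxy
    exact ⟨J, hJ.trans (subset_sUnion_of_mem hE), h⟩
  obtain ⟨T, hAT, hT⟩ := zorn_subset_nonempty _ hzorn A hA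
  exact ⟨T, hAT, hn.mono hAT, hT.prop, fun B hB hTB => hT.eq_of_le hB hTB⟩

theorem IsJordanCurve.exists_arc_through {X : Type*} [TopologicalSpace X] {J : Set X}
    (h : IsJordanCurve J) {u v x : X} (hu : u ∈ J) (hv : v ∈ J) (hx : x ∈ J) (huv : u ≠ v) :
    ∃ A ⊆ J, IsArc A u v ∧ x ∈ A := by
  obtain ⟨A, B, hA, hB, rfl, -⟩ := h.exists_arcs hu hv huv
  rcases hx with hx | hx
  · exact ⟨A, subset_union_left, hA, hx⟩
  · exact ⟨B, subset_union_right, hB, hx⟩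

theorem CycliclyConnected.exists_arc_through {X : Type*} [TopologicalSpace X] [T2Space X]
    {A : Set X} (hA : CycliclyConnected A) {u v x : X} (hu : u ∈ A) (hv : v ∈ A) (hx : x ∈ A)
    (huv : u ≠ v) : ∃ B ⊆ A, IsArc B u v ∧ x ∈ B := by
  by_cases hxu : x = u
  · obtain ⟨J, hJA, hJ, huJ, hvJ⟩ := hA u hu v hv huv
    obtain ⟨B, hB, h⟩ := hJ.exists_arc_through huJ hvJ huJ huv
    exact ⟨B, hB.trans hJA, hxu ▸ h⟩
  by_cases hxv : x = v
  · obtain ⟨J, hJA, hJ, huJ, hvJ⟩ := hA u hu v hv huv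
    obtain ⟨B, hB, h⟩ := hJ.exists_arc_through huJ hvJ hvJ huv
    exact ⟨B, hB.trans hJA, hxv ▸ h⟩
  obtain ⟨J, hJA, hJ, hxJ, huJ⟩ := hA x hx u hu hxu
  by_cases hvJ : v ∈ J
  · obtain ⟨B, hB, h⟩ := hJ.exists_arc_through huJ hvJ hxJ huv
    exact ⟨B, hB.trans hJA, h⟩
  obtain ⟨K, hKA, hK, hxK, hvK⟩ := hA x hx v hv hxv
  obtain ⟨P, hPK, hP, huP⟩ : ∃ P ⊆ K, IsArc P v x ∧ u ∉ P := by
    obtain ⟨P, Q, hP, hQ, hPQ, hPQi⟩ := hK.exists_arcs hvK hxK (Ne.symm hxv)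
    by_cases huP : u ∈ P
    · refine ⟨Q, hPQ ▸ subset_union_right, hQ, fun huQ => ?_⟩
      rcases hPQi.subset ⟨huP, huQ⟩ with h | h
      · exact huv h
      · exact hxu h.symm
    · exact ⟨P, hPQ ▸ subset_union_left, hP, huP⟩
  obtain ⟨w, hwJ, P', hP', hP'a, hP'J⟩ := hP.exists_first_hit hJ.isCompact.isClosed hvJ hxJ
  have huw : u ≠ w := fun h => huP (hP' (h ▸ hP'a.right_mem))
  obtain ⟨B, hBJ, hB, hxB⟩ := hJ.exists_arc_through huJ hwJ hxJ huw
  refine ⟨B ∪ P', union_subset (hBJ.trans hJA) (hP'.trans (hPK.trans hKA)),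
    hB.concat hP'a.symm ?_, Or.inl hxB⟩
  rw [← hP'J, inter_comm]
  exact inter_subset_inter_right _ hBJ

theorem CycliclyConnected.union_arc {X : Type*} [TopologicalSpace X] [T2Space X]
    {A E : Set X} (hA : CycliclyConnected A) {u v : X} (hu : u ∈ A) (hv : v ∈ A)
    (hE : IsArc E u v) (hEA : E ∩ A ⊆ {u, v}) : CycliclyConnected (A ∪ E) := by
  have key : ∀ x ∈ A, ∃ J ⊆ A ∪ E, IsJordanCurve J ∧ x ∈ J ∧ E ⊆ J := by
    intro x hx
    obtain ⟨B, hBA, hB, hxB⟩ := hA.exists_arc_through hu hv hx hE.ne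
    refine ⟨B ∪ E, union_subset_union_left _ hBA, hB.isJordanCurve_union hE ?_, Or.inl hxB,
      subset_union_right⟩
    rw [inter_comm]
    exact (inter_subset_inter_right _ hBA).trans hEA
  rintro x (hx | hx) y (hy | hy) hxy
  · obtain ⟨J, hJA, hJ⟩ := hA x hx y hy hxy
    exact ⟨J, hJA.trans subset_union_left, hJ⟩
  · obtain ⟨J, hJA, hJ, hxJ, hEJ⟩ := key x hx
    exact ⟨J, hJA, hJ, hxJ, hEJ hy⟩
  · obtain ⟨J, hJA, hJ, hyJ, hEJ⟩ := key y hy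
    exact ⟨J, hJA, hJ, hEJ hx, hyJ⟩
  · obtain ⟨J, hJA, hJ, -, hEJ⟩ := key u hu
    exact ⟨J, hJA, hJ, hEJ hx, hEJ hy⟩

theorem IsMaximalCyclic.arc_subset {X : Type*} [TopologicalSpace X] [T2Space X]
    {T E : Set X} (hT : IsMaximalCyclic T) {u v : X} (hu : u ∈ T) (hv : v ∈ T)
    (hE : IsArc E u v) (hET : E ∩ T ⊆ {u, v}) : E ⊆ T := by
  have := hT.2.2 _ (hT.2.1.union_arc hu hv hE hET) subset_union_left
  rw [this]; exact subset_union_right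

theorem exists_disjoint_connected_nhds {X : Type*} [MetricSpace X] [LocallyConnectedSpace X]
    {x y : X} (hxy : x ≠ y) : ∃ P Q : Set X, IsOpen P ∧ IsPreconnected P ∧ x ∈ P ∧
      IsOpen Q ∧ IsPreconnected Q ∧ y ∈ Q ∧ Disjoint P Q := by
  have hd : 0 < dist x y / 2 := half_pos (dist_pos.2 hxy)
  obtain ⟨P, hPo, hPc, hxP, hP, -⟩ := exists_connected_open_small x hd
  obtain ⟨Q, hQo, hQc, hyQ, hQ, -⟩ := exists_connected_open_small y hd
  exact ⟨P, Q, hPo, hPc, hxP, hQo, hQc, hyQ,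
    (ball_disjoint_ball (by linarith)).mono hP hQ⟩

/-- A connected open set disjoint from a maximal cyclic set touches it in at most one point. -/
theorem IsMaximalCyclic.subsingleton_inter_closure {X : Type*} [MetricSpace X] [CompactSpace X]
    [LocallyConnectedSpace X] {T U : Set X} (hT : IsMaximalCyclic T) (hTc : IsClosed T)
    (hU : IsOpen U) (hUc : IsPreconnected U) (hUT : Disjoint U T) :
    (T ∩ closure U).Subsingleton := by
  rintro u ⟨huT, huU⟩ v ⟨hvT, hvU⟩
  by_contra huv
  obtain ⟨P, Q, hPo, hPc, huP, hQo, hQc, hvQ, hPQ⟩ := exists_disjoint_connected_nhds huv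
  obtain ⟨p, hpP, hpU⟩ := mem_closure_iff.1 huU P hPo huP
  obtain ⟨q, hqQ, hqU⟩ := mem_closure_iff.1 hvU Q hQo hvQ
  have hpT := disjoint_left.1 hUT hpU
  have hqT := disjoint_left.1 hUT hqU
  obtain ⟨A₀, hA₀, hA₀a⟩ := hPo.exists_isArc hPc hpP huP (fun h => hpT (h ▸ huT))
  obtain ⟨B₀, hB₀, hB₀a⟩ := hQo.exists_isArc hQc hqQ hvQ (fun h => hqT (h ▸ hvT))
  obtain ⟨w, hwT, A, hA, hAa, hAT⟩ := hA₀a.exists_first_hit hTc hpT huT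
  obtain ⟨z, hzT, B, hB, hBa, hBT⟩ := hB₀a.exists_first_hit hTc hqT hvT
  have hAP := hA.trans hA₀
  have hBQ := hB.trans hB₀
  obtain ⟨D₀, hD₀, hD₀a⟩ := hU.exists_isArc hUc hpU hqU (hPQ.ne_of_mem hpP hqQ)
  have hAB : Disjoint A B := hPQ.mono hAP hBQ
  obtain ⟨s, hsA, t, htB, D, hD, hDa, hDA, hDB⟩ := hD₀a.exists_between hAa.isCompact.isClosed
    hBa.isCompact.isClosed hAB hAa.left_mem hBa.left_mem
  have hDU := hD.trans hD₀
  have hsT := disjoint_left.1 hUT (hDU hDa.left_mem)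
  have htT := disjoint_left.1 hUT (hDU hDa.right_mem)
  obtain ⟨A', hA', hA'a⟩ := hAa.exists_subarc hAa.right_mem hsA (fun h => hsT (h ▸ hwT))
  obtain ⟨B', hB', hB'a⟩ := hBa.exists_subarc htB hBa.right_mem (fun h => htT (h ▸ hzT))
  have h1 : IsArc (A' ∪ D) w t := hA'a.concat hDa (by
    rw [← hDA, inter_comm]; exact inter_subset_inter_right _ hA')
  have h2 : IsArc (A' ∪ D ∪ B') w z := h1.concat hB'a (by
    rw [union_inter_distrib_right, (hAB.mono hA' hB').inter_eq, empty_union, ← hDB]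
    exact inter_subset_inter_right _ hB')
  refine hsT (hT.arc_subset hwT hzT h2 ?_ (Or.inl (Or.inr hDa.left_mem)))
  rintro y ⟨(hy | hy) | hy, hyT⟩
  · left
    have : y ∈ A ∩ T := ⟨hA' hy, hyT⟩
    rwa [hAT] at this
  · exact absurd hyT (disjoint_left.1 hUT (hDU hy))
  · right
    have : y ∈ B ∩ T := ⟨hB' hy, hyT⟩
    rwa [hBT] at this

theorem exists_mem_closure_connectedComponentIn {X : Type*} [TopologicalSpace X]
    [LocallyConnectedSpace X] {T L : Set X} (hTc : IsClosed T) (hL : IsPreconnected L) {y : X}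
    (h1 : (L ∩ connectedComponentIn Tᶜ y).Nonempty) (h2 : (L ∩ T).Nonempty) :
    ∃ z ∈ L, z ∈ T ∧ z ∈ closure (connectedComponentIn Tᶜ y) := by
  have hUo : ∀ y, IsOpen (connectedComponentIn Tᶜ y) := fun y =>
    hTc.isOpen_compl.connectedComponentIn
  by_contra! hno
  have hsub : L ⊆ connectedComponentIn Tᶜ y ∪ (closure (connectedComponentIn Tᶜ y))ᶜ := by
    intro z hz
    by_cases hzc : z ∈ closure (connectedComponentIn Tᶜ y)
    · left
      have hzT : z ∈ Tᶜ := fun hzT => hno z hz hzT hzc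
      obtain ⟨w, hw, hw'⟩ := mem_closure_iff.1 hzc _ (hUo z) (mem_connectedComponentIn hzT)
      rw [connectedComponentIn_eq hw', ← connectedComponentIn_eq hw]
      exact mem_connectedComponentIn hzT
    · exact Or.inr hzc
  obtain ⟨w, hwL, hwT⟩ := h2
  obtain ⟨z, -, hz1, hz2⟩ := hL _ _ (hUo y) isClosed_closure.isOpen_compl hsub h1
    ⟨w, hwL, fun h => hno w hwL hwT h⟩
  exact hz2 (subset_closure hz1)

/-- The retraction onto a closed maximal cyclic set collapsing every complementary component to
the point where it is attached. -/
theorem IsMaximalCyclic.exists_retraction {X : Type*} [MetricSpace X] [CompactSpace X]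
    [PreconnectedSpace X] [LocallyConnectedSpace X] {T : Set X} (hT : IsMaximalCyclic T)
    (hTc : IsClosed T) : ∃ r : X → X, Continuous r ∧ (∀ y, r y ∈ T) ∧ (∀ y ∈ T, r y = y) ∧
      ∀ L, IsPreconnected L → ((L ∩ T).Nonempty → r '' L ⊆ L) ∧
        (Disjoint L T → (r '' L).Subsingleton) := by
  have hUo : ∀ y, IsOpen (connectedComponentIn Tᶜ y) := fun y =>
    hTc.isOpen_compl.connectedComponentIn
  have hex : ∀ y, ∃ z ∈ T, (y ∈ T → z = y) ∧
      (y ∉ T → z ∈ closure (connectedComponentIn Tᶜ y)) := by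
    intro y
    by_cases hy : y ∈ T
    · exact ⟨y, hy, fun _ => rfl, fun h => absurd hy h⟩
    · obtain ⟨z, -, hz, hzc⟩ := exists_mem_closure_connectedComponentIn hTc isPreconnected_univ
        ⟨y, mem_univ y, mem_connectedComponentIn (show y ∈ Tᶜ from hy)⟩
        (by rw [univ_inter]; exact hT.1.nonempty)
      exact ⟨z, hz, fun h => absurd h hy, fun _ => hzc⟩
  choose r hrT hr1 hr2 using hex
  have huniq : ∀ y, y ∉ T → ∀ z ∈ T, z ∈ closure (connectedComponentIn Tᶜ y) → r y = z :=
    fun y hy z hz hzc => hT.subsingleton_inter_closure hTc (hUo y)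
      isPreconnected_connectedComponentIn
      (disjoint_left.2 fun w hw => connectedComponentIn_subset _ _ hw) ⟨hrT y, hr2 y hy⟩ ⟨hz, hzc⟩
  have hin : ∀ L, IsPreconnected L → (L ∩ T).Nonempty → ∀ y ∈ L, r y ∈ L := by
    intro L hL hLT y hy
    by_cases hyT : y ∈ T
    · rwa [hr1 y hyT]
    · obtain ⟨z, hzL, hzT, hzc⟩ := exists_mem_closure_connectedComponentIn hTc hL
        ⟨y, hy, mem_connectedComponentIn (show y ∈ Tᶜ from hyT)⟩ hLT
      rwa [huniq y hyT z hzT hzc]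
  have hconst : ∀ L, IsPreconnected L → Disjoint L T → ∀ x ∈ L, ∀ y ∈ L, r x = r y := by
    intro L hL hLT x hx y hy
    have hsub := hL.subset_connectedComponentIn hx (subset_compl_iff_disjoint_right.2 hLT)
    refine huniq x (disjoint_left.1 hLT hx) _ (hrT y) ?_
    rw [connectedComponentIn_eq (hsub hy)]
    exact hr2 y (disjoint_left.1 hLT hy)
  refine ⟨r, ?_, hrT, hr1, fun L hL => ⟨?_, ?_⟩⟩
  · rw [continuous_iff_continuousAt]
    intro y
    by_cases hy : y ∈ T
    · rw [ContinuousAt, hr1 y hy, Metric.tendsto_nhds]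
      intro ε hε
      obtain ⟨V, hVo, hVc, hyV, hV, -⟩ := exists_connected_open_small y hε
      filter_upwards [hVo.mem_nhds hyV] with z hz
      exact hV (hin V hVc ⟨y, hyV, hy⟩ z hz)
    · refine (continuousAt_const (y := r y)).congr ?_
      have hym : y ∈ connectedComponentIn Tᶜ y := mem_connectedComponentIn hy
      filter_upwards [(hUo y).mem_nhds hym] with z hz
      exact hconst _ isPreconnected_connectedComponentIn
        (disjoint_left.2 fun w hw => connectedComponentIn_subset _ _ hw) y hym z hz
  · rintro hLT _ ⟨y, hy, rfl⟩
    exact hin L hL hLT y hy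
  · rintro hLT _ ⟨x, hx, rfl⟩ _ ⟨y, hy, rfl⟩
    exact hconst L hL hLT x hx y hy

theorem exists_connected_open_superset {X : Type*} [TopologicalSpace X]
    [LocallyConnectedSpace X] {K O : Set X} (hK : IsPreconnected K) (hne : K.Nonempty)
    (hO : IsOpen O) (hKO : K ⊆ O) : ∃ V ⊆ O, IsOpen V ∧ IsPreconnected V ∧ K ⊆ V := by
  obtain ⟨k, hk⟩ := hne
  exact ⟨connectedComponentIn O k, connectedComponentIn_subset _ _, hO.connectedComponentIn,
    isPreconnected_connectedComponentIn, hK.subset_connectedComponentIn hk hKO⟩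

/-- Two disjoint continua crossing from `P` to `Q` yield a Jordan curve crossing from `P` to
`Q`. -/
theorem exists_isJordanCurve_of_disjoint {X : Type*} [MetricSpace X] [CompactSpace X]
    [LocallyConnectedSpace X] {K L P Q : Set X} (hK : IsCompact K) (hKc : IsPreconnected K)
    (hL : IsCompact L) (hLc : IsPreconnected L) (hKL : Disjoint K L) (hP : IsOpen P)
    (hPc : IsPreconnected P) (hQ : IsOpen Q) (hQc : IsPreconnected Q) (hPQ : Disjoint P Q)
    (hKP : (K ∩ P).Nonempty) (hKQ : (K ∩ Q).Nonempty) (hLP : (L ∩ P).Nonempty)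
    (hLQ : (L ∩ Q).Nonempty) :
    ∃ J, IsJordanCurve J ∧ (J ∩ P).Nonempty ∧ (J ∩ Q).Nonempty := by
  obtain ⟨O₁, O₂, hO₁, hO₂, hKO, hLO, hO⟩ := SeparatedNhds.of_isCompact_isCompact hK hL hKL
  obtain ⟨V₁, hV₁, hV₁o, hV₁c, hKV⟩ := exists_connected_open_superset hKc hKP.left hO₁ hKO
  obtain ⟨V₂, hV₂, hV₂o, hV₂c, hLV⟩ := exists_connected_open_superset hLc hLP.left hO₂ hLO
  obtain ⟨p₁, hp₁K, hp₁⟩ := hKP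
  obtain ⟨q₁, hq₁K, hq₁⟩ := hKQ
  obtain ⟨p₂, hp₂L, hp₂⟩ := hLP
  obtain ⟨q₂, hq₂L, hq₂⟩ := hLQ
  obtain ⟨A, hA, hAa⟩ := hV₁o.exists_isArc hV₁c (hKV hp₁K) (hKV hq₁K) (hPQ.ne_of_mem hp₁ hq₁)
  obtain ⟨B, hB, hBa⟩ := hV₂o.exists_isArc hV₂c (hLV hp₂L) (hLV hq₂L) (hPQ.ne_of_mem hp₂ hq₂)
  have hAB : Disjoint A B := hO.mono (hA.trans hV₁) (hB.trans hV₂)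
  obtain ⟨D₀, hD₀, hD₀a⟩ := hP.exists_isArc hPc hp₁ hp₂ (hKL.ne_of_mem hp₁K hp₂L)
  obtain ⟨E₀, hE₀, hE₀a⟩ := hQ.exists_isArc hQc hq₁ hq₂ (hKL.ne_of_mem hq₁K hq₂L)
  obtain ⟨s, hsA, t, htB, D, hD, hDa, hDA, hDB⟩ := hD₀a.exists_between hAa.isCompact.isClosed
    hBa.isCompact.isClosed hAB hAa.left_mem hBa.left_mem
  obtain ⟨s', hs'A, t', ht'B, E, hE, hEa, hEA, hEB⟩ := hE₀a.exists_between
    hAa.isCompact.isClosed hBa.isCompact.isClosed hAB hAa.right_mem hBa.right_mem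
  have hDP := hD.trans hD₀
  have hEQ := hE.trans hE₀
  have hsP := hDP hDa.left_mem
  have hs'Q := hEQ hEa.left_mem
  obtain ⟨A', hA', hA'a⟩ := hAa.exists_subarc hsA hs'A (hPQ.ne_of_mem hsP hs'Q)
  obtain ⟨B', hB', hB'a⟩ := hBa.exists_subarc htB ht'B
    (hPQ.ne_of_mem (hDP hDa.right_mem) (hEQ hEa.right_mem))
  have h1 : IsArc (D ∪ B') s t' := hDa.concat hB'a (by
    rw [← hDB]; exact inter_subset_inter_right _ hB')
  have h2 : IsArc (D ∪ B' ∪ E) s s' := h1.concat hEa.symm (by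
    rw [union_inter_distrib_right, (hPQ.mono hDP hEQ).inter_eq, empty_union, ← hEB, inter_comm]
    exact inter_subset_inter_right _ hB')
  refine ⟨_, hA'a.isJordanCurve_union h2 ?_, ⟨s, Or.inl hA'a.left_mem, hsP⟩,
    ⟨s', Or.inl hA'a.right_mem, hs'Q⟩⟩
  rintro y ⟨hyA, (hy | hy) | hy⟩
  · left
    have : y ∈ D ∩ A := ⟨hy, hA' hyA⟩
    rwa [hDA] at this
  · exact absurd (hB' hy) (disjoint_left.1 hAB (hA' hyA))
  · right
    have : y ∈ E ∩ A := ⟨hy, hA' hyA⟩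
    rwa [hEA] at this

/-! ## Continua of convergence -/

theorem isClosed_connectedComponentIn {X : Type*} [TopologicalSpace X] {F : Set X}
    (hF : IsClosed F) (x : X) : IsClosed (connectedComponentIn F x) := by
  by_cases hx : x ∈ F
  · rw [connectedComponentIn_eq_image hx]
    exact hF.isClosedEmbedding_subtypeVal.isClosedMap _ isClosed_connectedComponent
  · rw [connectedComponentIn_eq_empty hx]; exact isClosed_empty

/-- Boundary bumping. -/
theorem exists_mem_connectedComponentIn_of_level {X : Type*} [TopologicalSpace X] [T2Space X]
    {K : Set X} (hK : IsCompact K) (hKc : IsPreconnected K) {f : X → ℝ} (hf : Continuous f)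
    {ρ : ℝ} {y : X} (hy : y ∈ K) (hyρ : f y < ρ) (hw : ∃ w ∈ K, ρ ≤ f w) :
    ∃ z ∈ connectedComponentIn (K ∩ f ⁻¹' Iic ρ) y, f z = ρ := by
  by_contra! hno
  have hF : IsCompact (K ∩ f ⁻¹' Iic ρ) := hK.inter_right (isClosed_Iic.preimage hf)
  have hyF : y ∈ K ∩ f ⁻¹' Iic ρ := ⟨hy, hyρ.le⟩
  set F := K ∩ f ⁻¹' Iic ρ
  have : CompactSpace F := isCompact_iff_compactSpace.1 hF
  let V : { s : Set F // IsClopen s ∧ (⟨y, hyF⟩ : F) ∈ s } → Set F := fun s => s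
  have : Nonempty { s : Set F // IsClopen s ∧ (⟨y, hyF⟩ : F) ∈ s } :=
    ⟨⟨univ, isClopen_univ, mem_univ _⟩⟩
  have hdir : Directed (· ⊇ ·) V := fun s t =>
    ⟨⟨s ∩ t, s.2.1.inter t.2.1, s.2.2, t.2.2⟩, inter_subset_left, inter_subset_right⟩
  obtain ⟨⟨Z, hZ, hyZ⟩, hZU⟩ := exists_subset_nhds_of_isCompact hdir
    (fun s => s.2.1.isClosed.isCompact) (U := {z : F | f z < ρ}) (by
      intro z hz
      refine (isOpen_lt (by fun_prop) continuous_const).mem_nhds ?_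
      rw [← connectedComponent_eq_iInter_isClopen] at hz
      refine lt_of_le_of_ne z.2.2 (hno z ?_)
      rw [connectedComponentIn_eq_image hyF]
      exact mem_image_of_mem _ hz)
  have hcl : ∀ S : Set F, IsClosed S → IsClosed (Subtype.val '' S) :=
    hF.isClosed.isClosedEmbedding_subtypeVal.isClosedMap
  obtain ⟨w, hwK, hw⟩ := hw
  obtain ⟨p, hpK, ⟨⟨p, hpF⟩, hp, rfl⟩, hp'⟩ := isPreconnected_closed_iff.1 hKc (Subtype.val '' Z)
    (Subtype.val '' Zᶜ ∪ f ⁻¹' Ici ρ) (hcl _ hZ.isClosed)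
    ((hcl _ hZ.compl.isClosed).union (isClosed_Ici.preimage hf)) (by
      intro p hp
      by_cases hpρ : ρ ≤ f p
      · exact Or.inr (Or.inr hpρ)
      · have hpF : p ∈ F := ⟨hp, (not_le.1 hpρ).le⟩
        by_cases hpZ : (⟨p, hpF⟩ : F) ∈ Z
        · exact Or.inl ⟨_, hpZ, rfl⟩
        · exact Or.inr (Or.inl ⟨_, hpZ, rfl⟩)) ⟨y, hy, _, hyZ, rfl⟩ ⟨w, hwK, Or.inr hw⟩
  rcases hp' with ⟨q, hq, hqp⟩ | hp'
  · exact hq (by rwa [Subtype.ext hqp])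
  · exact absurd (show f p < ρ from hZU hp) (not_lt.2 hp')

theorem exists_disjoint_continua {Y : Type*} [MetricSpace Y] [CompactSpace Y]
    [PreconnectedSpace Y] (h : ¬ LocallyConnectedSpace Y) :
    ∃ (L : ℕ → Set Y) (a q : ℕ → Y) (x z : Y),
      (∀ n, IsCompact (L n) ∧ IsPreconnected (L n) ∧ a n ∈ L n ∧ q n ∈ L n) ∧
      (∀ m n, m ≠ n → Disjoint (L m) (L n)) ∧ Tendsto a atTop (𝓝 x) ∧ Tendsto q atTop (𝓝 z) ∧
      x ≠ z := by
  rw [locallyConnectedSpace_iff_connected_subsets] at h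
  push Not at h
  obtain ⟨x, U, hU, hno⟩ := h
  obtain ⟨ε, hε, hεU⟩ := Metric.nhds_basis_closedBall.mem_iff.1 hU
  let K : Y → Set Y := connectedComponentIn (closedBall x ε)
  have hKcl : ∀ y, IsClosed (K y) := isClosed_connectedComponentIn isClosed_closedBall
  have hKself : ∀ y ∈ closedBall x ε, y ∈ K y := fun y hy => mem_connectedComponentIn hy
  have hKsub : ∀ y, K y ⊆ closedBall x ε := fun y => connectedComponentIn_subset _ _
  have hKx : K x ∉ 𝓝 x := fun hK =>
    hno (K x) hK isPreconnected_connectedComponentIn ((hKsub x).trans hεU)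
  have hKeq : ∀ y z, z ∈ K y → K y = K z := fun y z hz => connectedComponentIn_eq hz
  have hxself : x ∈ K x := hKself x (mem_closedBall_self hε.le)
  obtain ⟨y, hyP, hyr⟩ := exists_seq_of_forall_finset_exists
    (fun y => y ∈ ball x ε ∧ x ∉ K y)
    (fun y y' => K y ≠ K y' ∧ dist y' x ≤ dist y x / 2) (by
      intro s hs
      have hN : ball x ε ∩ ⋂ y ∈ s, ((K y)ᶜ ∩ ball x (dist y x / 2)) ∈ 𝓝 x := by
        refine inter_mem (ball_mem_nhds x hε) ((biInter_finset_mem s).2 fun y hy => ?_)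
        refine inter_mem ((hKcl y).isOpen_compl.mem_nhds (hs y hy).2) (ball_mem_nhds x ?_)
        refine half_pos (dist_pos.2 fun h => (hs y hy).2 ?_)
        rw [h]; exact hxself
      obtain ⟨y', hy', hy'K⟩ := not_subset.1 fun hsub => hKx (mem_of_superset hN hsub)
      have hy'c := ball_subset_closedBall hy'.1
      refine ⟨y', ⟨hy'.1, fun hx => hy'K ?_⟩, fun y hy => ?_⟩
      · rw [← hKeq _ _ hx]; exact hKself y' hy'c
      · have := mem_iInter₂.1 hy'.2 y hy
        exact ⟨fun h => this.1 (h ▸ hKself y' hy'c), this.2.le⟩)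
  have hex : ∃ w, ε ≤ dist w x := by
    by_contra! hall
    have huniv : closedBall x ε = univ := eq_univ_of_forall fun w => (hall w).le
    refine hKx ?_
    have : K x = univ := by
      simp only [K, huniv]
      exact connectedComponentIn_univ x |>.trans (PreconnectedSpace.connectedComponent_eq_univ x)
    rw [this]; exact univ_mem
  have hq : ∀ n, ∃ q ∈ K (y n), dist q x = ε := by
    intro n
    obtain ⟨w, hw⟩ := hex
    obtain ⟨z, hz, hzε⟩ := exists_mem_connectedComponentIn_of_level (K := univ) isCompact_univ
      isPreconnected_univ (f := fun z => dist z x) (by fun_prop) (mem_univ (y n)) (hyP n).1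
      ⟨w, mem_univ w, hw⟩
    rw [univ_inter] at hz
    exact ⟨z, hz, hzε⟩
  choose q hqK hqd using hq
  obtain ⟨z, -, φ, hφ, hz⟩ := isCompact_univ.tendsto_subseq fun n => mem_univ (q n)
  have hylim : Tendsto y atTop (𝓝 x) := by
    rw [tendsto_iff_dist_tendsto_zero]
    have hbd : ∀ n, dist (y n) x ≤ ε * (1 / 2) ^ n := by
      intro n
      induction n with
      | zero => simpa using (hyP 0).1.le
      | succ n ih =>
        have := (hyr n (n + 1) n.lt_succ_self).2
        rw [pow_succ]; linarith
    refine squeeze_zero (fun n => dist_nonneg) hbd ?_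
    simpa using (tendsto_pow_atTop_nhds_zero_of_lt_one (r := (1 / 2 : ℝ)) (by norm_num)
      (by norm_num)).const_mul ε
  refine ⟨fun n => K (y (φ n)), fun n => y (φ n), fun n => q (φ n), x, z, fun n =>
    ⟨(hKcl _).isCompact, isPreconnected_connectedComponentIn,
      hKself _ (ball_subset_closedBall (hyP _).1), hqK _⟩, ?_, hylim.comp hφ.tendsto_atTop, hz, ?_⟩
  · have key : ∀ m n, m < n → Disjoint (K (y m)) (K (y n)) := by
      intro m n hmn
      rw [disjoint_left]
      intro w h1 h2
      exact (hyr m n hmn).1 ((hKeq _ _ h1).trans (hKeq _ _ h2).symm)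
    intro m n hmn
    rcases lt_or_gt_of_ne (hφ.injective.ne hmn) with h | h
    · exact key _ _ h
    · exact (key _ _ h).symm
  · intro hxz
    have h1 : Tendsto (fun n => dist (q (φ n)) x) atTop (𝓝 (dist z x)) :=
      hz.dist tendsto_const_nhds
    simp only [hqd] at h1
    have h2 := tendsto_nhds_unique h1 tendsto_const_nhds
    rw [hxz, dist_self] at h2
    exact hε.ne h2

/-- A compact set that embeds locally in the line contains no null-intersecting sequence of
nondegenerate continua. -/
theorem not_exists_continua_of_locally_injective {X : Type*} [MetricSpace X] {S : Set X}
    (hS : IsCompact S)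
    (hloc : ∀ x ∈ S, ∃ W ∈ 𝓝 x, ∃ f : X → ℝ, ContinuousOn f (W ∩ S) ∧ InjOn f (W ∩ S))
    {M : ℕ → Set X} {a q : ℕ → X} {x z : X}
    (hM : ∀ n, IsCompact (M n) ∧ IsPreconnected (M n) ∧ a n ∈ M n ∧ q n ∈ M n ∧ M n ⊆ S)
    (hdisj : ∀ m n, m ≠ n → Disjoint (M m) (M n)) (ha : Tendsto a atTop (𝓝 x))
    (hq : Tendsto q atTop (𝓝 z)) : x = z := by
  by_contra hxz
  have hxS : x ∈ S := hS.isClosed.mem_of_tendsto ha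
    (Eventually.of_forall fun n => (hM n).2.2.2.2 (hM n).2.2.1)
  obtain ⟨W, hW, f, hfc, hfi⟩ := hloc x hxS
  obtain ⟨ρ₀, hρ₀, hρ₀W⟩ := Metric.nhds_basis_closedBall.mem_iff.1 hW
  have hd : 0 < dist z x := dist_pos.2 (Ne.symm hxz)
  obtain ⟨ρ, hρ, hρρ₀, hρd⟩ : ∃ ρ, 0 < ρ ∧ ρ ≤ ρ₀ ∧ ρ < dist z x :=
    ⟨min ρ₀ (dist z x / 2), lt_min hρ₀ (half_pos hd), min_le_left _ _,
      (min_le_right _ _).trans_lt (half_lt_self hd)⟩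
  have hρW : closedBall x ρ ⊆ W := (closedBall_subset_closedBall hρρ₀).trans hρ₀W
  have hxW : x ∈ W ∩ S := ⟨mem_of_mem_nhds hW, hxS⟩
  have hsph : IsCompact (f '' (S ∩ sphere x ρ)) :=
    (hS.inter_right isClosed_sphere).image_of_continuousOn
      (hfc.mono fun w hw => ⟨hρW (sphere_subset_closedBall hw.2), hw.1⟩)
  have hfx : f x ∉ f '' (S ∩ sphere x ρ) := by
    rintro ⟨w, ⟨hwS, hw⟩, hwx⟩
    have := hfi ⟨hρW (sphere_subset_closedBall hw), hwS⟩ hxW hwx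
    rw [this, mem_sphere, dist_self] at hw
    exact hρ.ne hw
  obtain ⟨η, hη, hηb⟩ := Metric.isOpen_iff.1 hsph.isClosed.isOpen_compl (f x) hfx
  have hbelow : ∀ w ∈ S, dist w x = ρ → η ≤ dist (f w) (f x) := fun w hw hwρ =>
    not_lt.1 fun hlt => hηb hlt ⟨w, ⟨hw, hwρ⟩, rfl⟩
  have haS : Tendsto (fun n => f (a n)) atTop (𝓝 (f x)) := by
    refine (hfc x hxW).tendsto.comp (tendsto_nhdsWithin_iff.2 ⟨ha, ?_⟩)
    filter_upwards [ha hW] with n hn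
    exact ⟨hn, (hM n).2.2.2.2 (hM n).2.2.1⟩
  have hev : ∀ᶠ n in atTop, dist (f (a n)) (f x) < η ∧ dist (a n) x < ρ ∧ ρ < dist (q n) x :=
    (haS.eventually (ball_mem_nhds _ hη)).and ((ha.eventually (ball_mem_nhds _ hρ)).and
      ((hq.dist tendsto_const_nhds).eventually_const_lt hρd))
  obtain ⟨n₀, hn₀⟩ := eventually_atTop.1 hev
  have hside : ∀ n, n₀ ≤ n →
      (∃ w ∈ M n ∩ W, f w = f x - η) ∨ (∃ w ∈ M n ∩ W, f w = f x + η) := by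
    intro n hn
    obtain ⟨h1, h2, h3⟩ := hn₀ n hn
    obtain ⟨hMc, hMp, haM, hqM, hMS⟩ := hM n
    obtain ⟨w, hw, hwρ⟩ := exists_mem_connectedComponentIn_of_level hMc hMp
      (f := fun w => dist w x) (by fun_prop) haM h2 ⟨q n, hqM, h3.le⟩
    set N := connectedComponentIn (M n ∩ (fun w => dist w x) ⁻¹' Iic ρ) (a n) with hN
    have hNsub : N ⊆ M n ∩ (fun w => dist w x) ⁻¹' Iic ρ := connectedComponentIn_subset _ _
    have hNW : N ⊆ M n ∩ W := fun v hv => ⟨(hNsub hv).1, hρW (hNsub hv).2⟩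
    have haN : a n ∈ N := mem_connectedComponentIn ⟨haM, h2.le⟩
    have himg : IsPreconnected (f '' N) := isPreconnected_connectedComponentIn.image f
      (hfc.mono fun v hv => ⟨(hNW hv).2, hMS (hNW hv).1⟩)
    have hfw := hbelow w (hMS (hNsub hw).1) hwρ
    rw [Real.dist_eq] at h1 hfw
    rw [abs_lt] at h1
    rcases le_abs.1 hfw with h | h
    · right
      obtain ⟨v, hv, hvη⟩ := himg.Icc_subset (mem_image_of_mem f haN) (mem_image_of_mem f hw)
        (show f x + η ∈ Icc _ _ from ⟨by linarith, by linarith⟩)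
      exact ⟨v, hNW hv, hvη⟩
    · left
      obtain ⟨v, hv, hvη⟩ := himg.Icc_subset (mem_image_of_mem f hw) (mem_image_of_mem f haN)
        (show f x - η ∈ Icc _ _ from ⟨by linarith, by linarith⟩)
      exact ⟨v, hNW hv, hvη⟩
  have hclash : ∀ m n, m ≠ n → ∀ c, (∃ w ∈ M m ∩ W, f w = c) → (∃ w ∈ M n ∩ W, f w = c) →
      False := by
    rintro m n hmn c ⟨v, hv, hvc⟩ ⟨w, hw, hwc⟩
    have := hfi ⟨hv.2, (hM m).2.2.2.2 hv.1⟩ ⟨hw.2, (hM n).2.2.2.2 hw.1⟩ (hvc.trans hwc.symm)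
    exact disjoint_left.1 (hdisj m n hmn) hv.1 (this ▸ hw.1)
  rcases hside n₀ le_rfl with h0 | h0 <;> rcases hside (n₀ + 1) (by omega) with h1 | h1 <;>
    rcases hside (n₀ + 2) (by omega) with h2 | h2
  · exact hclash n₀ (n₀ + 1) (by omega) _ h0 h1
  · exact hclash n₀ (n₀ + 1) (by omega) _ h0 h1
  · exact hclash n₀ (n₀ + 2) (by omega) _ h0 h2
  · exact hclash (n₀ + 1) (n₀ + 2) (by omega) _ h1 h2
  · exact hclash (n₀ + 1) (n₀ + 2) (by omega) _ h1 h2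
  · exact hclash n₀ (n₀ + 2) (by omega) _ h0 h2
  · exact hclash n₀ (n₀ + 1) (by omega) _ h0 h1
  · exact hclash n₀ (n₀ + 1) (by omega) _ h0 h1

/-! ## Boundary components of surfaces and admissible continua -/

/-- Near every point, the boundary of a surface embeds in the line. -/
theorem IsSurface.exists_injOn_boundary {T : Type*} [TopologicalSpace T] (h : IsSurface T)
    (t : T) : ∃ W ∈ 𝓝 t, ∃ f : T → ℝ, ContinuousOn f W ∧ InjOn f (W ∩ surfaceBoundary T) := by
  classical
  obtain ⟨U, V, hU, htU, hV, ⟨e⟩⟩ := h t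
  let g : U → ℝ × ℝ := fun u => ((e u : HalfPlane) : ℝ × ℝ)
  have hg : IsEmbedding g := (IsEmbedding.subtypeVal.comp IsEmbedding.subtypeVal).comp
    e.isEmbedding
  have hrange : ∀ s : Set (ℝ × ℝ), IsOpen s → s ⊆ {p | 0 < p.2} → IsOpen (s ∩ range g) := by
    intro s hs hspos
    obtain ⟨O, hO, rfl⟩ := isOpen_induced_iff.1 hV
    have : s ∩ range g = s ∩ O := by
      ext p
      constructor
      · rintro ⟨hp, u, rfl⟩
        exact ⟨hp, (e u).2⟩
      · rintro ⟨hp, hpO⟩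
        refine ⟨hp, e.symm ⟨⟨p, le_of_lt (show (0 : ℝ) < p.2 from hspos hp)⟩, hpO⟩, ?_⟩
        simp [g]
    rw [this]; exact hs.inter hO
  have hbd : ∀ u : U, (u : T) ∈ surfaceBoundary T → (g u).2 = 0 := by
    intro u hu
    by_contra hne
    have hpos : 0 < (g u).2 := lt_of_le_of_ne (e u : HalfPlane).2 (Ne.symm hne)
    have hopen : IsOpen {p : ℝ × ℝ | 0 < p.2} := isOpen_lt continuous_const continuous_snd
    let s : Set U := g ⁻¹' {p | 0 < p.2}
    have hs : IsOpen s := hopen.preimage hg.continuous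
    refine hu ⟨Subtype.val '' s, g '' s, hU.isOpenMap_subtype_val _ hs, ⟨u, hpos, rfl⟩, ?_,
      ⟨(IsEmbedding.subtypeVal.homeomorphImage s).symm.trans (hg.homeomorphImage s)⟩⟩
    rw [image_preimage_eq_inter_range]
    exact hrange _ hopen subset_rfl
  refine ⟨U, hU.mem_nhds htU, fun y => if hy : y ∈ U then (g ⟨y, hy⟩).1 else 0, ?_, ?_⟩
  · rw [continuousOn_iff_continuous_domRestrict]
    refine (continuous_fst.comp hg.continuous).congr fun u => ?_
    simp
  · rintro x ⟨hx, hxb⟩ y ⟨hy, hyb⟩ hxy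
    simp only [hx, hy, dif_pos] at hxy
    have h2 : (g ⟨x, hx⟩).2 = (g ⟨y, hy⟩).2 := by
      rw [hbd ⟨x, hx⟩ hxb, hbd ⟨y, hy⟩ hyb]
    exact congrArg Subtype.val (hg.injective (Prod.ext hxy h2))

theorem IsBoundaryComponentOf.exists_injOn {X : Type*} [TopologicalSpace X] {T b : Set X}
    (hT : IsCompactSurface T) (hb : IsBoundaryComponentOf T b) :
    ∀ x ∈ b, ∃ W ∈ 𝓝 x, ∃ f : X → ℝ, ContinuousOn f (W ∩ b) ∧ InjOn f (W ∩ b) := by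
  classical
  obtain ⟨_, ⟨t₀, -, rfl⟩, rfl⟩ := hb
  set b' := connectedComponentIn (surfaceBoundary T) t₀
  have hb'S : b' ⊆ surfaceBoundary T := connectedComponentIn_subset _ _
  rintro _ ⟨t, ht, rfl⟩
  obtain ⟨W, hW, f, hfc, hfi⟩ := hT.2.2.2.exists_injOn_boundary t
  obtain ⟨W', hW', hWW'⟩ := (mem_nhds_subtype _ _ _).1 hW
  have hval : ∀ y : T, (if hy : (y : X) ∈ T then f ⟨y, hy⟩ else 0) = f y := fun y => by simp
  refine ⟨W', hW', fun y => if hy : y ∈ T then f ⟨y, hy⟩ else 0, ?_, ?_⟩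
  · have hsub : W' ∩ Subtype.val '' b' ⊆ T := by
      rintro _ ⟨-, y, -, rfl⟩; exact y.2
    have hmaps : MapsTo (inclusion hsub) univ W := fun y _ => hWW' y.2.1
    rw [continuousOn_iff_continuous_domRestrict]
    have := hfc.comp (continuous_inclusion hsub).continuousOn hmaps
    rw [continuousOn_univ] at this
    exact this.congr fun y => (hval (inclusion hsub y)).symm
  · rintro _ ⟨hx, x, hxb, rfl⟩ _ ⟨hy, y, hyb, rfl⟩ hxy
    simp only [hval] at hxy
    rw [hfi ⟨hWW' hx, hb'S hxb⟩ ⟨hWW' hy, hb'S hyb⟩ hxy]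

theorem IsBoundaryComponentOf.isPreconnected {X : Type*} [TopologicalSpace X] {T b : Set X}
    (hb : IsBoundaryComponentOf T b) : IsPreconnected b := by
  obtain ⟨_, ⟨t₀, -, rfl⟩, rfl⟩ := hb
  exact isPreconnected_connectedComponentIn.image _ continuous_subtype_val.continuousOn

/-- A connected set that embeds locally in the line coincides with every Jordan curve it
contains. -/
theorem IsJordanCurve.superset_of_locally_injective {X : Type*} [TopologicalSpace X] [T2Space X]
    {J b : Set X} (hJ : IsJordanCurve J) (hJb : J ⊆ b) (hb : IsPreconnected b)
    (hloc : ∀ x ∈ b, ∃ W ∈ 𝓝 x, ∃ f : X → ℝ, ContinuousOn f (W ∩ b) ∧ InjOn f (W ∩ b)) :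
    b ⊆ J := by
  have hopen : ∀ x ∈ J, ∃ O, IsOpen O ∧ x ∈ O ∧ O ∩ b ⊆ J := by
    intro x hx
    obtain ⟨W, hW, f, hfc, hfi⟩ := hloc x (hJb hx)
    obtain ⟨g, hg, hgJ, hgi⟩ := hJ.exists_periodic
    obtain ⟨s, rfl⟩ := hgJ ▸ hx
    have hgJ' : ∀ t, g t ∈ J := fun t => hgJ ▸ mem_range_self t
    obtain ⟨δ₀, hδ₀, hδ₀W⟩ := Metric.nhds_basis_closedBall.mem_iff.1
      (hg.continuousAt.preimage_mem_nhds hW)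
    obtain ⟨δ, hδ, hδδ₀, hδ1⟩ : ∃ δ, 0 < δ ∧ δ ≤ δ₀ ∧ δ ≤ 1 :=
      ⟨min δ₀ 1, lt_min hδ₀ one_pos, min_le_left _ _, min_le_right _ _⟩
    have hmaps : MapsTo g (Icc (s - δ) (s + δ)) (W ∩ b) := by
      intro t ht
      refine ⟨hδ₀W ?_, hJb (hgJ' t)⟩
      rw [← Real.closedBall_eq_Icc] at ht
      exact closedBall_subset_closedBall hδδ₀ ht
    have hinj : InjOn (f ∘ g) (Icc (s - δ) (s + δ)) := by
      refine hfi.comp (injOn_of_two_pi hgi fun u hu v hv => ?_) hmaps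
      have := Real.pi_gt_three
      rw [abs_lt]
      constructor <;> linarith [hu.1, hu.2, hv.1, hv.2]
    have hcont : ContinuousOn (f ∘ g) (Icc (s - δ) (s + δ)) := hfc.comp hg.continuousOn hmaps
    have hle : s - δ ≤ s + δ := by linarith
    have hs : s ∈ Icc (s - δ) (s + δ) := ⟨by linarith, by linarith⟩
    have hnhds : (f ∘ g) '' Icc (s - δ) (s + δ) ∈ 𝓝 (f (g s)) := by
      rcases hcont.strictMonoOn_of_injOn_Icc' hle hinj with hm | hm
      · exact mem_of_superset (Icc_mem_nhds (hm (left_mem_Icc.2 hle) hs (by linarith))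
          (hm hs (right_mem_Icc.2 hle) (by linarith))) (intermediate_value_Icc hle hcont)
      · exact mem_of_superset (Icc_mem_nhds (hm hs (right_mem_Icc.2 hle) (by linarith))
          (hm (left_mem_Icc.2 hle) hs (by linarith))) (intermediate_value_Icc' hle hcont)
    have hev := (hfc (g s) ⟨mem_of_mem_nhds hW, hJb hx⟩).preimage_mem_nhdsWithin hnhds
    rw [inter_comm W b, nhdsWithin_inter_of_mem' (mem_nhdsWithin_of_mem_nhds hW)] at hev
    obtain ⟨O, hO, hxO, hOsub⟩ := mem_nhdsWithin.1 hev
    obtain ⟨W₀, hW₀, hW₀o, hxW₀⟩ := mem_nhds_iff.1 hW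
    refine ⟨O ∩ W₀, hO.inter hW₀o, ⟨hxO, hxW₀⟩, ?_⟩
    rintro y ⟨⟨hyO, hyW⟩, hyb⟩
    obtain ⟨t, ht, hty⟩ := hOsub ⟨hyO, hyb⟩
    rw [← hfi (hmaps ht) ⟨hW₀ hyW, hyb⟩ hty]
    exact hgJ' t
  by_contra hsub
  obtain ⟨y, hyb, hyJ⟩ := not_subset.1 hsub
  obtain ⟨g, -, hgJ, -⟩ := hJ.exists_periodic
  have h0 : g 0 ∈ J := hgJ ▸ mem_range_self 0
  choose! O hO hxO hOJ using hopen
  obtain ⟨z, hzb, hzO, hzJ⟩ := hb (⋃ x ∈ J, O x) Jᶜ (isOpen_biUnion fun x hx => hO x hx)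
    hJ.isCompact.isClosed.isOpen_compl (by
      intro z _
      by_cases hzJ : z ∈ J
      · exact Or.inl (mem_biUnion hzJ (hxO z hzJ))
      · exact Or.inr hzJ) ⟨g 0, hJb h0, mem_biUnion h0 (hxO _ h0)⟩ ⟨y, hyb, hyJ⟩
  obtain ⟨x, hx, hzx⟩ := mem_iUnion₂.1 hzO
  exact hzJ (hOJ x hx ⟨hzx, hzb⟩)

theorem IsJordanCurve.image {X Y : Type*} [TopologicalSpace X] [TopologicalSpace Y] {f : X → Y}
    (hf : IsEmbedding f) {J : Set X} (hJ : IsJordanCurve J) : IsJordanCurve (f '' J) := by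
  obtain ⟨e⟩ := hJ
  exact ⟨(hf.homeomorphImage J).symm.trans e⟩

theorem CycliclyConnected.image {X Y : Type*} [TopologicalSpace X] [TopologicalSpace Y]
    {f : X → Y} (hf : IsEmbedding f) {A : Set X} (hA : CycliclyConnected A) :
    CycliclyConnected (f '' A) := by
  rintro _ ⟨x, hx, rfl⟩ _ ⟨y, hy, rfl⟩ hxy
  obtain ⟨J, hJA, hJ, hxJ, hyJ⟩ := hA x hx y hy fun h => hxy (congrArg f h)
  exact ⟨f '' J, image_mono hJA, hJ.image hf, mem_image_of_mem f hxJ, mem_image_of_mem f hyJ⟩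

/-- Disjoint continua joining points near `x` to points near `z ≠ x` have traces of the same kind
on some maximal cyclic set. -/
theorem exists_continua_in_isMaximalCyclic {X : Type*} [MetricSpace X] [CompactSpace X]
    [PreconnectedSpace X] [LocallyConnectedSpace X]
    (hcl : ∀ T : Set X, IsMaximalCyclic T → IsClosed T) {L : ℕ → Set X} {a q : ℕ → X} {x z : X}
    (hL : ∀ n, IsCompact (L n) ∧ IsPreconnected (L n) ∧ a n ∈ L n ∧ q n ∈ L n)
    (hdisj : ∀ m n, m ≠ n → Disjoint (L m) (L n)) (ha : Tendsto a atTop (𝓝 x))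
    (hq : Tendsto q atTop (𝓝 z)) (hxz : x ≠ z) :
    ∃ (T : Set X) (r : X → X) (n₀ : ℕ), IsMaximalCyclic T ∧ Continuous r ∧ r x ≠ r z ∧
      ∀ n, n₀ ≤ n → r '' L n ⊆ T ∩ L n := by
  obtain ⟨P, Q, hP, hPc, hxP, hQ, hQc, hzQ, hPQ⟩ := exists_disjoint_connected_nhds hxz
  obtain ⟨n₀, hn₀⟩ := eventually_atTop.1
    ((ha.eventually (hP.mem_nhds hxP)).and (hq.eventually (hQ.mem_nhds hzQ)))
  have h0 := hn₀ n₀ le_rfl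
  have h1 := hn₀ (n₀ + 1) (by omega)
  obtain ⟨J, hJ, ⟨p, hpJ, hpP⟩, ⟨w, hwJ, hwQ⟩⟩ := exists_isJordanCurve_of_disjoint (hL n₀).1
    (hL n₀).2.1 (hL (n₀ + 1)).1 (hL (n₀ + 1)).2.1 (hdisj _ _ (by omega)) hP hPc hQ hQc hPQ
    ⟨_, (hL n₀).2.2.1, h0.1⟩ ⟨_, (hL n₀).2.2.2, h0.2⟩ ⟨_, (hL (n₀ + 1)).2.2.1, h1.1⟩
    ⟨_, (hL (n₀ + 1)).2.2.2, h1.2⟩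
  obtain ⟨T, hJT, hT⟩ := hJ.cycliclyConnected.exists_isMaximalCyclic
    ⟨p, hpJ, w, hwJ, hPQ.ne_of_mem hpP hwQ⟩
  obtain ⟨r, hr, hrT, -, hrL⟩ := hT.exists_retraction (hcl T hT)
  have hrP : ∀ y ∈ P, r y ∈ P := fun y hy =>
    (hrL P hPc).1 ⟨p, hpP, hJT hpJ⟩ (mem_image_of_mem r hy)
  have hrQ : ∀ y ∈ Q, r y ∈ Q := fun y hy =>
    (hrL Q hQc).1 ⟨w, hwQ, hJT hwJ⟩ (mem_image_of_mem r hy)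
  refine ⟨T, r, n₀, hT, hr, hPQ.ne_of_mem (hrP x hxP) (hrQ z hzQ), fun n hn => ?_⟩
  have hLT : (L n ∩ T).Nonempty := by
    by_contra hne
    have hd : Disjoint (L n) T := disjoint_iff_inter_eq_empty.2 (not_nonempty_iff_eq_empty.1 hne)
    exact hPQ.ne_of_mem (hrP _ (hn₀ n hn).1) (hrQ _ (hn₀ n hn).2)
      ((hrL _ (hL n).2.1).2 hd (mem_image_of_mem r (hL n).2.2.1)
        (mem_image_of_mem r (hL n).2.2.2))
  refine subset_inter ?_ ((hrL _ (hL n).2.1).1 hLT)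
  rintro _ ⟨y, -, rfl⟩
  exact hrT y

theorem IsAdmissible.locallyConnectedSpace {X : Type*} [MetricSpace X] [CompactSpace X]
    [PreconnectedSpace X] [LocallyConnectedSpace X]
    (hsurf : ∀ T : Set X, IsMaximalCyclic T → IsCompactSurface ↥T) {C : Set X}
    (hC : IsAdmissible C) : LocallyConnectedSpace C := by
  have : CompactSpace C := isCompact_iff_compactSpace.1 hC.1.1
  have : PreconnectedSpace C := isPreconnected_iff_preconnectedSpace.1 hC.1.2.isPreconnected
  have hcl : ∀ T : Set X, IsMaximalCyclic T → IsClosed T := fun T hT =>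
    (isCompact_iff_compactSpace.2 (hsurf T hT).1).isClosed
  by_contra hno
  obtain ⟨L, a, q, x, z, hL, hdisj, ha, hq, hxz⟩ := exists_disjoint_continua hno
  have hcv : Continuous (Subtype.val : C → X) := continuous_subtype_val
  have ha' := (hcv.tendsto x).comp ha
  have hq' := (hcv.tendsto z).comp hq
  have hdisj' : ∀ m n, m ≠ n → Disjoint (Subtype.val '' L m) (Subtype.val '' L n) := fun m n h =>
    (disjoint_image_iff Subtype.val_injective).2 (hdisj m n h)
  obtain ⟨T, r, n₀, hT, hr, hrxz, hrL⟩ := exists_continua_in_isMaximalCyclic hcl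
    (L := fun n => Subtype.val '' L n) (fun n => ⟨(hL n).1.image hcv,
      (hL n).2.1.image _ hcv.continuousOn, mem_image_of_mem _ (hL n).2.2.1,
      mem_image_of_mem _ (hL n).2.2.2⟩) hdisj' ha' hq' (Subtype.val_injective.ne hxz)
  have hTC : ∀ n, n₀ ≤ n → r '' (Subtype.val '' L n) ⊆ T ∩ C := fun n hn =>
    (hrL n hn).trans (inter_subset_inter_right _ (by rintro _ ⟨y, -, rfl⟩; exact y.2))
  have hTCc : IsCompact (T ∩ C) := hC.1.1.inter_left (hcl T hT)
  have hshift : ∀ {u : ℕ → X} {y : X}, Tendsto u atTop (𝓝 y) →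
      Tendsto (fun n => r (u (n + n₀))) atTop (𝓝 (r y)) := fun hu =>
    (hr.tendsto _).comp ((tendsto_add_atTop_iff_nat n₀).2 hu)
  have hmem : ∀ {u : ℕ → C} {y : X}, (∀ n, u n ∈ L n) →
      Tendsto (Subtype.val ∘ u) atTop (𝓝 y) → r y ∈ T ∩ C := fun hu hy =>
    hTCc.isClosed.mem_of_tendsto (hshift hy) (Eventually.of_forall fun n =>
      hTC (n + n₀) (by omega) (mem_image_of_mem r (mem_image_of_mem _ (hu _))))
  rcases hC.2 T hT with hsub | hb
  · exact hrxz (hsub (hmem (fun n => (hL n).2.2.1) ha') (hmem (fun n => (hL n).2.2.2) hq'))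
  · refine hrxz (not_exists_continua_of_locally_injective hTCc (hb.exists_injOn (hsurf T hT))
      (M := fun n => r '' (Subtype.val '' L (n + n₀))) (fun n => ?_) (fun m n hmn => ?_)
      (hshift ha') (hshift hq'))
    · obtain ⟨h1, h2, h3, h4⟩ := hL (n + n₀)
      exact ⟨(h1.image hcv).image hr, (h2.image _ hcv.continuousOn).image _ hr.continuousOn,
        mem_image_of_mem r (mem_image_of_mem _ h3), mem_image_of_mem r (mem_image_of_mem _ h4),
        hTC _ (by omega)⟩
    · exact (hdisj' (m + n₀) (n + n₀) (by omega)).mono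
        ((hrL _ (by omega)).trans inter_subset_right) ((hrL _ (by omega)).trans inter_subset_right)

theorem IsAdmissible.isJordanCurve_of_isMaximalCyclic {X : Type*} [TopologicalSpace X] [T2Space X]
    (hsurf : ∀ T : Set X, IsMaximalCyclic T → IsCompactSurface ↥T) {C : Set X}
    (hC : IsAdmissible C) {S : Set C} (hS : IsMaximalCyclic S) : IsJordanCurve S := by
  have hval : IsEmbedding (Subtype.val : C → X) := IsEmbedding.subtypeVal
  obtain ⟨x, hx, y, hy, hxy⟩ := hS.1
  obtain ⟨J, hJS, hJ, -⟩ := hS.2.1 x hx y hy hxy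
  have hSn : (Subtype.val '' S).Nontrivial := hS.1.image Subtype.val_injective
  obtain ⟨T, hST, hT⟩ := (hS.2.1.image hval).exists_isMaximalCyclic hSn
  have hSTC : Subtype.val '' S ⊆ T ∩ C :=
    subset_inter hST (by rintro _ ⟨y, -, rfl⟩; exact y.2)
  rcases hC.2 T hT with hsub | hb
  · exact absurd (hsub.anti hSTC) (not_subsingleton_iff.2 hSn)
  · have := (hJ.image hval).superset_of_locally_injective ((image_mono hJS).trans hSTC)
      hb.isPreconnected (hb.exists_injOn (hsurf T hT))
    have hSJ : S ⊆ J := (image_subset_image_iff Subtype.val_injective).1 (hSTC.trans this)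
    rwa [hSJ.antisymm hJS]

/-! ## STATEMENT 8 -/

theorem stmt8 (X : Type) [MetricSpace X] (hX : IsPeano X)
    (hsurf : ∀ T : Set X, IsMaximalCyclic T → IsCompactSurface ↥T)
    (C : Set X) (hC : IsAdmissible C) :
    IsOneCactoid ↥C := by
  obtain ⟨h1, h2, h3⟩ := hX
  exact ⟨⟨isCompact_iff_compactSpace.1 hC.1.1, isConnected_iff_connectedSpace.1 hC.1.2,
    hC.locallyConnectedSpace hsurf⟩, fun T hT => hC.isJordanCurve_of_isMaximalCyclic hsurf hT⟩
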